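/- arXiv:0912.4748 — 3 statements merged into one kernel-verified Lean document; each statement's English description precedes it below -/
import Mathlib

section
/- Let n, k, r be positive integers with n ≥ rk, and let μ(r) be the number of prime divisors of r counted with multiplicity. Then the chromatic number of the almost 2^{μ(r)}-stable Kneser hypergraph KG^r([n] choose k)~_{2^{μ(r)}-stab} equals ⌈(n-(k-1)r)/(r-1)⌉. -/
/-- `S` has all pairwise distances at least `s`. -/
def stab (s : ℕ) (S : Finset ℕ) : Prop :=
  ∀ i ∈ S, ∀ j ∈ S, i ≠ j → i + s ≤ j ∨ j + s ≤ i

/-- `V n k s`: the `k`-subsets of `[n] = {1,…,n}` with pairwise distances at least `s`. -/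
def V (n k s : ℕ) : Set (Finset ℕ) :=
  {S | S ⊆ Finset.Icc 1 n ∧ S.card = k ∧ stab s S}

/-- `c` is a proper coloring of `KG^r([n] choose k)~_{s-stab}`. -/
def IsProperCol (r n k s t : ℕ) (c : Finset ℕ → Fin t) : Prop :=
  ∀ f : Fin r → Finset ℕ, (∀ i, f i ∈ V n k s) →
    (∀ i j, i ≠ j → Disjoint (f i) (f j)) → ∃ i j, c (f i) ≠ c (f j)

/-- Formal linear combinations of words in the alphabet `P`. -/
abbrev WordModule (K P : Type*) [Semiring K] := List P →₀ K

namespace WordModule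

section
variable {K P J : Type*} [CommRing K]

/-- Prepending the letter `a`. -/
noncomputable def cons (a : P) : WordModule K P →ₗ[K] WordModule K P :=
  Finsupp.lmapDomain K K (List.cons a)

/-- Applying a map letter by letter. -/
noncomputable def map (f : P → J) : WordModule K P →ₗ[K] WordModule K J :=
  Finsupp.lmapDomain K K (List.map f)

/-- The alternating sum of the words obtained from a word by deleting one letter. -/
noncomputable def bdWord : List P → WordModule K P
  | [] => 0
  | a :: l => Finsupp.single l 1 - cons a (bdWord l)

/-- The (augmented) simplicial boundary. -/
noncomputable def bd : WordModule K P →ₗ[K] WordModule K P :=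
  Finsupp.linearCombination K bdWord

/-- The prism over a word, between the word and its image under `f`. -/
noncomputable def prismWord (f : P → P) : List P → WordModule K P
  | [] => 0
  | a :: l => Finsupp.single (a :: f a :: l.map f) 1 - cons a (prismWord f l)

/-- The prism operator, a chain homotopy between the identity and `map f`. -/
noncomputable def prism (f : P → P) : WordModule K P →ₗ[K] WordModule K P :=
  Finsupp.linearCombination K (prismWord f)

@[simp] lemma cons_single (a : P) (l : List P) (x : K) :
    cons a (Finsupp.single l x) = Finsupp.single (a :: l) x := by
  simp [cons, Finsupp.mapDomain_single]

@[simp] lemma map_single (f : P → J) (l : List P) (x : K) :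
    map f (Finsupp.single l x) = Finsupp.single (l.map f) x := by
  simp [map, Finsupp.mapDomain_single]

@[simp] lemma bd_single (l : List P) : bd (Finsupp.single l (1 : K)) = bdWord l := by
  simp [bd]

@[simp] lemma prism_single (f : P → P) (l : List P) :
    prism f (Finsupp.single l (1 : K)) = prismWord f l := by
  simp [prism]

lemma linear_ext {M : Type*} [AddCommGroup M] [Module K M] {φ ψ : WordModule K P →ₗ[K] M}
    (h : ∀ l, φ (Finsupp.single l 1) = ψ (Finsupp.single l 1)) (w : WordModule K P) :
    φ w = ψ w := by
  have : φ = ψ := by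
    ext l
    simpa using h l
  rw [this]

lemma bd_cons (a : P) (w : WordModule K P) : bd (cons a w) = w - cons a (bd w) :=
  linear_ext (φ := bd ∘ₗ cons a) (ψ := LinearMap.id - cons a ∘ₗ bd)
    (fun l => by simp [bdWord]) w

lemma map_cons (f : P → J) (a : P) (w : WordModule K P) :
    map f (cons a w) = cons (f a) (map f w) :=
  linear_ext (φ := map f ∘ₗ cons a) (ψ := cons (f a) ∘ₗ map f) (fun l => by simp) w

lemma prism_cons (f : P → P) (a : P) (w : WordModule K P) :
    prism f (cons a w) = cons a (cons (f a) (map f w)) - cons a (prism f w) :=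
  linear_ext (φ := prism f ∘ₗ cons a)
    (ψ := cons a ∘ₗ cons (f a) ∘ₗ map f - cons a ∘ₗ prism f)
    (fun l => by simp [prismWord]) w

lemma bd_map (f : P → J) (w : WordModule K P) : bd (map f w) = map f (bd w) := by
  refine linear_ext (φ := bd ∘ₗ map f) (ψ := map f ∘ₗ bd) (fun l => ?_) w
  induction l with
  | nil => simp [bdWord]
  | cons a l ih =>
    simp only [LinearMap.comp_apply, map_single, bd_single] at ih ⊢
    simp [bdWord, map_cons, ih]

lemma bd_bd (w : WordModule K P) : bd (bd w) = 0 := by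
  refine linear_ext (φ := bd ∘ₗ bd) (ψ := 0) (fun l => ?_) w
  induction l with
  | nil => simp [bdWord]
  | cons a l ih =>
    simp only [LinearMap.comp_apply, bd_single, LinearMap.zero_apply] at ih ⊢
    simp [bdWord, bd_cons, ih]

lemma bd_prism (f : P → P) (w : WordModule K P) :
    bd (prism f w) = map f w - w - prism f (bd w) := by
  refine linear_ext (φ := bd ∘ₗ prism f) (ψ := map f - LinearMap.id - prism f ∘ₗ bd)
    (fun l => ?_) w
  induction l with
  | nil => simp [bdWord, prismWord]
  | cons a l ih =>
    simp only [LinearMap.comp_apply, bd_single, LinearMap.sub_apply, prism_single, map_single,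
      LinearMap.id_apply] at ih ⊢
    have h := bd_map (K := K) f (Finsupp.single l 1)
    simp only [map_single, bd_single] at h
    simp only [prismWord, map_sub, bd_single, bdWord, bd_cons, ih, prism_cons, prism_single,
      cons_single, List.map_cons, h]
    abel

/-- The cone with apex `e` over `map f w`, glued to the prism between `w` and `map f w`. -/
noncomputable def fill (e : P) (f : P → P) (w : WordModule K P) : WordModule K P :=
  cons e (map f w) - prism f w

lemma bd_fill (e : P) (f : P → P) {w : WordModule K P} (hw : bd w = 0) :
    bd (fill e f w) = w := by
  simp [fill, bd_cons, bd_map, bd_prism, hw]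

lemma linearCombination_mem_supported {S : Set (List P)} {T : Set (List J)}
    {g : List P → WordModule K J} (hg : ∀ l ∈ S, g l ∈ Finsupp.supported K K T)
    {w : WordModule K P} (hw : w ∈ Finsupp.supported K K S) :
    Finsupp.linearCombination K g w ∈ Finsupp.supported K K T := by
  rw [Finsupp.linearCombination_apply]
  exact Submodule.finsuppSum_mem _ _ _ _ fun l hl =>
    Submodule.smul_mem _ _ (hg l (hw (Finsupp.mem_support_iff.2 hl)))

lemma lmapDomain_mem_supported {S : Set (List P)} {T : Set (List J)}
    {g : List P → List J} (hg : ∀ l ∈ S, g l ∈ T)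
    {w : WordModule K P} (hw : w ∈ Finsupp.supported K K S) :
    Finsupp.lmapDomain K K g w ∈ Finsupp.supported K K T := by
  classical
  intro l hl
  obtain ⟨m, hm, rfl⟩ := Finset.mem_image.1 (Finsupp.mapDomain_support hl)
  exact hg m (hw hm)

lemma cons_mem {S T : Set (List P)} {a : P} (h : ∀ l ∈ S, a :: l ∈ T)
    {w : WordModule K P} (hw : w ∈ Finsupp.supported K K S) :
    cons a w ∈ Finsupp.supported K K T :=
  lmapDomain_mem_supported h hw

lemma map_mem {S : Set (List P)} {T : Set (List J)} {f : P → J} (h : ∀ l ∈ S, l.map f ∈ T)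
    {w : WordModule K P} (hw : w ∈ Finsupp.supported K K S) :
    map f w ∈ Finsupp.supported K K T :=
  lmapDomain_mem_supported h hw

lemma linear_ext_on {M : Type*} [AddCommGroup M] [Module K M] {φ ψ : WordModule K P →ₗ[K] M}
    {S : Set (List P)} (h : ∀ l ∈ S, φ (Finsupp.single l 1) = ψ (Finsupp.single l 1))
    {w : WordModule K P} (hw : w ∈ Finsupp.supported K K S) : φ w = ψ w := by
  rw [Finsupp.supported_eq_span_single] at hw
  refine LinearMap.eqOn_span ?_ hw
  rintro _ ⟨l, hl, rfl⟩
  exact h l hl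

/-- The set of words of length `m`. -/
def ofLength (P : Type*) (m : ℕ) : Set (List P) := {l | l.length = m}

lemma bdWord_mem (l : List P) (m : ℕ) (hl : l.length = m + 1) :
    (bdWord l : WordModule K P) ∈ Finsupp.supported K K (ofLength P m) := by
  induction l generalizing m with
  | nil => simp at hl
  | cons a l ih =>
    refine Submodule.sub_mem _ (Finsupp.single_mem_supported _ _ (by simpa [ofLength] using hl)) ?_
    rcases m with _ | m
    · have : l = [] := by simpa using hl
      simp [this, bdWord]
    · exact cons_mem (S := ofLength P m) (fun l hl => by simpa [ofLength] using hl)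
        (ih m (by simpa using hl))

lemma bd_mem {m : ℕ} {w : WordModule K P} (hw : w ∈ Finsupp.supported K K (ofLength P (m + 1))) :
    bd w ∈ Finsupp.supported K K (ofLength P m) :=
  linearCombination_mem_supported (fun l hl => bdWord_mem l m hl) hw

open Classical in
/-- The projection which kills the words with two equal consecutive letters. -/
noncomputable def reduce : WordModule K P →ₗ[K] WordModule K P :=
  Finsupp.linearCombination K fun l => if l.IsChain (· ≠ ·) then Finsupp.single l 1 else 0

lemma reduce_of_isChain {l : List P} (hl : l.IsChain (· ≠ ·)) :
    reduce (Finsupp.single l (1 : K)) = Finsupp.single l 1 := by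
  simp [reduce, hl]

lemma reduce_of_not_isChain {l : List P} (hl : ¬ l.IsChain (· ≠ ·)) :
    reduce (Finsupp.single l (1 : K)) = 0 := by
  simp [reduce, hl]

lemma reduce_mem {S : Set (List P)} {w : WordModule K P}
    (hw : w ∈ Finsupp.supported K K S) : reduce w ∈ Finsupp.supported K K S := by
  refine linearCombination_mem_supported (fun l hl => ?_) hw
  split_ifs
  · exact Finsupp.single_mem_supported _ _ hl
  · exact Submodule.zero_mem _

lemma reduce_cons_reduce (a : P) (w : WordModule K P) :
    reduce (cons a (reduce w)) = reduce (cons a w) := by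
  refine linear_ext (φ := reduce ∘ₗ cons a ∘ₗ reduce) (ψ := reduce ∘ₗ cons a)
    (fun l => ?_) w
  by_cases hl : l.IsChain (· ≠ ·)
  · simp [reduce_of_isChain hl]
  · have : ¬ (a :: l).IsChain (· ≠ ·) := fun h => hl h.tail
    simp [reduce_of_not_isChain hl, reduce_of_not_isChain this]

lemma reduce_cons_cons_self (a : P) (w : WordModule K P) :
    reduce (cons a (cons a w)) = 0 := by
  refine linear_ext (φ := reduce ∘ₗ cons a ∘ₗ cons a) (ψ := 0) (fun l => ?_) w
  have : ¬ (a :: a :: l).IsChain (· ≠ ·) := by simp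
  simp [reduce_of_not_isChain this]

lemma reduce_bd_reduce (w : WordModule K P) :
    reduce (bd (reduce w)) = reduce (bd w) := by
  refine linear_ext (φ := reduce ∘ₗ bd ∘ₗ reduce) (ψ := reduce ∘ₗ bd) (fun l => ?_) w
  by_cases hl : l.IsChain (· ≠ ·)
  · simp [reduce_of_isChain hl]
  simp only [LinearMap.comp_apply, reduce_of_not_isChain hl, map_zero, bd_single]
  induction l with
  | nil => simp at hl
  | cons a l ih =>
    by_cases h : l.IsChain (· ≠ ·)
    · rcases l with _ | ⟨b, l⟩
      · simp at hl
      · obtain rfl : a = b := by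
          by_contra hab
          exact hl (List.isChain_cons_cons.2 ⟨hab, h⟩)
        simp [bdWord, reduce_cons_cons_self]
    · rw [bdWord, map_sub, reduce_of_not_isChain h, ← reduce_cons_reduce, ← ih h]
      simp

lemma reduce_map {f : P → J} (hf : Function.Injective f) (w : WordModule K P) :
    reduce (map f w) = map f (reduce w) := by
  refine linear_ext (φ := reduce ∘ₗ map f) (ψ := map f ∘ₗ reduce) (fun l => ?_) w
  have key : (l.map f).IsChain (· ≠ ·) ↔ l.IsChain (· ≠ ·) := by
    rw [List.isChain_map]
    simp [hf.ne_iff]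
  by_cases hl : l.IsChain (· ≠ ·)
  · simp [reduce_of_isChain hl, reduce_of_isChain (key.2 hl)]
  · simp [reduce_of_not_isChain hl, reduce_of_not_isChain (mt key.1 hl)]

lemma prismWord_mem {f : P → P} {r : P → P → Prop} {good : P → Prop}
    (hr : ∀ x y z, r x y → r y z → r x z)
    (hf : ∀ x y, r x y → r (f x) (f y)) (hgood : ∀ x, good x → r x (f x)) (l : List P)
    (hl : l.Pairwise r) (hlg : ∀ x ∈ l, good x) :
    (prismWord f l : WordModule K P) ∈ Finsupp.supported K K
      {w | w.length = l.length + 1 ∧ w.Pairwise r ∧ ∀ x ∈ w, ∃ y ∈ l, x = y ∨ x = f y} := by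
  induction l with
  | nil => exact Submodule.zero_mem _
  | cons a l ih =>
    rw [List.pairwise_cons] at hl
    have ha := hgood a (hlg a (by simp))
    have hmap : ∀ y ∈ l, r a (f y) := fun y hy => hr _ _ _ ha (hf _ _ (hl.1 y hy))
    refine Submodule.sub_mem _ (Finsupp.single_mem_supported _ _ ⟨by simp, ?_, ?_⟩)
      (cons_mem ?_ (ih hl.2 fun x hx => hlg x (by simp [hx])))
    · rw [List.pairwise_cons, List.pairwise_cons]
      refine ⟨?_, ?_, ?_⟩
      · intro y hy
        simp only [List.mem_cons, List.mem_map] at hy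
        rcases hy with rfl | ⟨z, hz, rfl⟩
        · exact ha
        · exact hmap z hz
      · intro y hy
        obtain ⟨z, hz, rfl⟩ := List.mem_map.1 hy
        exact hf _ _ (hl.1 z hz)
      · exact hl.2.map f hf
    · intro x hx
      simp only [List.mem_cons, List.mem_map] at hx
      rcases hx with rfl | rfl | ⟨z, hz, rfl⟩
      · exact ⟨x, by simp⟩
      · exact ⟨a, by simp⟩
      · exact ⟨z, by simp [hz]⟩
    · rintro w ⟨h1, h2, h3⟩
      refine ⟨by simp [h1], List.pairwise_cons.2 ⟨fun x hx => ?_, h2⟩, fun x hx => ?_⟩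
      · obtain ⟨y, hy, rfl | rfl⟩ := h3 x hx
        · exact hl.1 _ hy
        · exact hmap y hy
      · rcases List.mem_cons.1 hx with rfl | hx
        · exact ⟨x, by simp⟩
        · obtain ⟨y, hy, h⟩ := h3 x hx
          exact ⟨y, by simp [hy], h⟩

end

end WordModule

section FreeAction

/-- The maps `ν - 1` (in even degrees) and `1 + ν + ⋯ + ν ^ (p - 1)` (in odd degrees), which
alternate in the periodic resolution of the cyclic group of order `p`. -/
def resolutionMap {R : Type*} [Ring R] (p : ℕ) (ν : R) (i : ℕ) : R :=
  if Even i then ν - 1 else ∑ j ∈ Finset.range p, ν ^ j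

lemma resolutionMap_mul_succ {R : Type*} [Ring R] {p : ℕ} {ν : R} (h : ν ^ p = 1) (i : ℕ) :
    resolutionMap p ν (i + 1) * resolutionMap p ν i = 0 := by
  by_cases hi : Even i
  · simp [resolutionMap, hi, Nat.even_add_one, geom_sum_mul, h]
  · simp [resolutionMap, hi, Nat.even_add_one, mul_geom_sum, h]

lemma Commute.resolutionMap_right {R : Type*} [Ring R] {p : ℕ} {ν b : R} (h : Commute b ν)
    (i : ℕ) : Commute b (resolutionMap p ν i) := by
  unfold resolutionMap
  split_ifs
  · exact h.sub_right (Commute.one_right b)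
  · exact Commute.sum_right _ _ _ fun j _ => h.pow_right j

lemma resolutionMap_apply_mem {K M : Type*} [CommRing K] [AddCommGroup M] [Module K M] {p : ℕ}
    {ν : Module.End K M} {W : Submodule K M} (h : ∀ w ∈ W, ν w ∈ W) (i : ℕ) {w : M}
    (hw : w ∈ W) : resolutionMap p ν i w ∈ W := by
  have hpow : ∀ j, (ν ^ j) w ∈ W := fun j => by
    induction j with
    | zero => simpa
    | succ j ih => rw [pow_succ', Module.End.mul_apply]; exact h _ ih
  unfold resolutionMap
  split_ifs
  · exact W.sub_mem (h w hw) hw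
  · rw [LinearMap.sum_apply]
    exact W.sum_mem fun j _ => hpow j

lemma resolutionMap_comm_of_comm {K M M' : Type*} [CommRing K] [AddCommGroup M] [Module K M]
    [AddCommGroup M'] [Module K M'] {p : ℕ} {ν : Module.End K M} {ν' : Module.End K M'}
    {φ : M →ₗ[K] M'} {W : Submodule K M} (h : ∀ w ∈ W, ν w ∈ W)
    (hφ : ∀ w ∈ W, φ (ν w) = ν' (φ w)) (i : ℕ) {w : M} (hw : w ∈ W) :
    φ (resolutionMap p ν i w) = resolutionMap p ν' i (φ w) := by
  have hpow : ∀ j, (ν ^ j) w ∈ W ∧ φ ((ν ^ j) w) = (ν' ^ j) (φ w) := fun j => by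
    induction j with
    | zero => simpa
    | succ j ih =>
      rw [pow_succ', pow_succ', Module.End.mul_apply, Module.End.mul_apply, ← ih.2]
      exact ⟨h _ ih.1, hφ _ ih.1⟩
  unfold resolutionMap
  split_ifs
  · simp [hφ w hw]
  · rw [LinearMap.sum_apply, LinearMap.sum_apply, map_sum]
    exact Finset.sum_congr rfl fun j _ => (hpow j).2

/-- A complex of free modules over a cyclic group of order `p`, whose augmentation is nontrivial
and extends to a map from the periodic resolution, is nonzero in degree `m`. -/
lemma ne_zero_of_exact {p : ℕ} {M : Type*} [AddCommGroup M] [Module (ZMod p) M]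
    [Nontrivial (ZMod p)]
    (ν b : Module.End (ZMod p) M) (hcomm : Commute b ν) (hbb : b * b = 0)
    (W : ℕ → Submodule (ZMod p) M) (hbW : ∀ i, ∀ w ∈ W (i + 1), b w ∈ W i)
    (hexact : ∀ i j, ∀ z ∈ W (j + 1), resolutionMap p ν (i + 1) z = 0 →
      ∃ e ∈ W (j + 1), z = resolutionMap p ν i e)
    (a : M →ₗ[ZMod p] ZMod p) (ha : ∀ w, a (ν w) = a w)
    (d : ℕ → M) (hdW : ∀ i, d i ∈ W (i + 1))
    (m : ℕ) (hd : ∀ i < m, b (d (i + 1)) = resolutionMap p ν i (d i)) (hd0 : a (b (d 0)) = 1) :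
    d m ≠ 0 := by
  intro hm
  have hb : ∀ i w, b (resolutionMap p ν i w) = resolutionMap p ν i (b w) := fun i w => by
    rw [← Module.End.mul_apply, (hcomm.resolutionMap_right i).eq, Module.End.mul_apply]
  have hbb' : ∀ w, b (b w) = 0 := fun w => by
    rw [← Module.End.mul_apply, hbb, LinearMap.zero_apply]
  have hN : ∀ w, a (resolutionMap p ν 1 w) = 0 := fun w => by
    have hpow : ∀ j, a ((ν ^ j) w) = a w := fun j => by
      induction j with
      | zero => simp
      | succ j ih => rw [pow_succ', Module.End.mul_apply, ha, ih]
    simp [resolutionMap, hpow]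
  have key : ∀ k i, i + k = m → ∃ e ∈ W (i + 1), d i - resolutionMap p ν (i + 1) e ∈
      LinearMap.range (b.domRestrict (W (i + 2))) := by
    intro k
    induction k with
    | zero =>
      rintro i rfl
      have h0 : d i = 0 := hm
      exact ⟨0, Submodule.zero_mem _, by rw [h0, map_zero, sub_zero]; exact Submodule.zero_mem _⟩
    | succ k ih =>
      intro i hi
      obtain ⟨e, he, ⟨⟨e', he'⟩, h⟩⟩ := ih (i + 1) (by omega)
      simp only [LinearMap.domRestrict_apply] at h
      have h1 := congrArg b h
      rw [hbb', map_sub, hd i (by omega), hb] at h1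
      have hp : resolutionMap p ν (i + 1 + 1) = resolutionMap p ν i := by
        simp [resolutionMap, Nat.even_add_one]
      have hz : resolutionMap p ν (i + 1 + 1) (d i - b e) = 0 := by
        rw [hp] at h1 ⊢
        rw [map_sub, ← h1]
      obtain ⟨e₂, he₂, h₂⟩ := hexact (i + 1) i (d i - b e)
        ((W _).sub_mem (hdW i) (hbW _ _ he)) hz
      refine ⟨e₂, he₂, ⟨⟨e, he⟩, ?_⟩⟩
      rw [LinearMap.domRestrict_apply, ← h₂]
      abel
  obtain ⟨e, he, ⟨⟨e', he'⟩, h⟩⟩ := key m 0 (by simp)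
  simp only [LinearMap.domRestrict_apply] at h
  have h1 := congrArg (fun x => a (b x)) h
  simp only [hbb', map_sub, hb, hN, hd0, zero_add] at h1
  simp at h1

lemma lmapDomain_perm_pow_apply {K B : Type*} [CommRing K] (τ : Equiv.Perm B) (j : ℕ)
    (z : B →₀ K) (x : B) :
    (((Finsupp.lmapDomain K K τ : Module.End K (B →₀ K)) ^ j) z) x = z ((τ⁻¹ ^ j) x) := by
  induction j generalizing x with
  | zero => simp
  | succ j ih =>
    rw [pow_succ', Module.End.mul_apply, Finsupp.lmapDomain_apply, Finsupp.mapDomain_equiv_apply,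
      ih, pow_succ, Equiv.Perm.mul_apply]
    rfl

lemma exists_eq_resolutionMap {p : ℕ} [NeZero p] {K B : Type*} [CommRing K] (τ : Equiv.Perm B)
    (S : Set B) (hS : ∀ x, τ x ∈ S ↔ x ∈ S) (s : B → ZMod p) (hs : ∀ x ∈ S, s (τ x) = s x + 1)
    (i : ℕ) (z : B →₀ K) (hz : z ∈ Finsupp.supported K K S)
    (h : resolutionMap p (Finsupp.lmapDomain K K τ : Module.End K (B →₀ K)) (i + 1) z = 0) :
    ∃ e ∈ Finsupp.supported K K S,
      z = resolutionMap p (Finsupp.lmapDomain K K τ : Module.End K (B →₀ K)) i e := by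
  classical
  set ν : Module.End K (B →₀ K) := Finsupp.lmapDomain K K τ with hν
  obtain ⟨σ, hσ⟩ : ∃ σ, σ = τ⁻¹ := ⟨_, rfl⟩
  have hτσ : ∀ x, τ (σ x) = x := fun x => by rw [hσ]; exact τ.apply_symm_apply x
  have hν1 : ∀ (z : B →₀ K) x, (ν z) x = z (σ x) := fun z x => by
    have := lmapDomain_perm_pow_apply τ 1 z x
    rwa [pow_one, pow_one, ← hσ] at this
  have hνj : ∀ (z : B →₀ K) j x, ((ν ^ j) z) x = z ((σ ^ j) x) := fun z j x =>
    hσ ▸ lmapDomain_perm_pow_apply τ j z x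
  have hS' : ∀ x, σ x ∈ S ↔ x ∈ S := fun x => by rw [← hS, hτσ]
  have hs' : ∀ x ∈ S, s (σ x) = s x - 1 := fun x hx => by
    have := hs _ ((hS' x).2 hx)
    rw [hτσ] at this
    rw [this]; ring
  have hSj : ∀ j : ℕ, ∀ x, (σ ^ j) x ∈ S ↔ x ∈ S := fun j x => by
    induction j with
    | zero => simp
    | succ j ih => rw [pow_succ', Equiv.Perm.mul_apply, hS', ih]
  have hsj : ∀ j : ℕ, ∀ x ∈ S, s ((σ ^ j) x) = s x - j := fun j x hx => by
    induction j with
    | zero => simp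
    | succ j ih =>
      rw [pow_succ', Equiv.Perm.mul_apply, hs' _ ((hSj j x).2 hx), ih]
      push_cast; ring
  have hzS : ∀ x ∉ S, z x = 0 := fun x hx => by
    by_contra h0
    exact hx (hz (by simpa using h0))
  have hνz : ∀ j, (ν ^ j) z ∈ Finsupp.supported K K S := fun j x hx => by
    by_contra hxS
    simp only [Finset.mem_coe, Finsupp.mem_support_iff, hνj] at hx
    exact hx (hzS _ fun h => hxS ((hSj j x).1 h))
  by_cases hi : Even i
  · have hN : ∀ x, ∑ j ∈ Finset.range p, z ((σ ^ j) x) = 0 := fun x => by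
      have := DFunLike.congr_fun h x
      simpa [resolutionMap, hi, Nat.even_add_one, LinearMap.sum_apply, Finsupp.finsetSum_apply,
        hνj] using this
    refine ⟨-∑ j ∈ Finset.range p, ((ν ^ j) z).filter (fun x => j ≤ (s x).val),
      Submodule.neg_mem _ (Submodule.sum_mem _ fun j _ => ?_), ?_⟩
    · refine subset_trans (Finset.coe_subset.2 ?_) (hνz j)
      rw [Finsupp.support_filter]
      exact Finset.filter_subset _ _
    · ext x
      have he : ∀ x, (∑ j ∈ Finset.range p, ((ν ^ j) z).filter (fun x => j ≤ (s x).val)) x =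
          ∑ j ∈ Finset.range ((s x).val + 1), z ((σ ^ j) x) := fun x => by
        rw [Finsupp.finsetSum_apply]
        simp only [Finsupp.filter_apply, hνj]
        rw [← Finset.sum_filter]
        congr 1
        ext j
        have := ZMod.val_lt (s x)
        simp only [Finset.mem_filter, Finset.mem_range]
        omega
      simp only [resolutionMap, hi, if_true, LinearMap.sub_apply, Module.End.one_apply, map_neg,
        Finsupp.sub_apply, Finsupp.neg_apply, hν1, he]
      by_cases hx : x ∈ S
      · have hstep : ∀ j, (σ ^ j) (σ x) = (σ ^ (j + 1)) x := fun j => by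
          rw [pow_succ, Equiv.Perm.mul_apply]
        rw [hs' x hx]
        by_cases h0 : s x = 0
        · have hp : (s x - 1).val + 1 = p := by
            rw [h0, zero_sub]
            obtain ⟨q, rfl⟩ := Nat.exists_eq_succ_of_ne_zero (NeZero.ne p)
            rw [ZMod.val_neg_one]
          rw [hp, hN, h0]
          simp
        · have hp : (s x).val = (s x - 1).val + 1 := by
            have h1 : 1 ≤ (s x).val := Nat.one_le_iff_ne_zero.2 (by simpa using h0)
            have hlt := ZMod.val_lt (s x)
            have : s x - 1 = (((s x).val - 1 : ℕ) : ZMod p) := by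
              rw [Nat.cast_sub h1, ZMod.natCast_zmod_val, Nat.cast_one]
            rw [this, ZMod.val_natCast_of_lt (by omega)]
            omega
          rw [hp, Finset.sum_range_succ' _ ((s x - 1).val + 1)]
          simp [hstep]
      · have h0 : ∀ j, z ((σ ^ j) x) = 0 := fun j => hzS _ fun h => hx ((hSj j x).1 h)
        have h1 : ∀ j, z ((σ ^ j) (σ x)) = 0 := fun j =>
          hzS _ fun h => hx ((hS' x).1 ((hSj j _).1 h))
        simp [h0, h1, hzS x hx]
  · have hinv : ∀ x, z (σ x) = z x := fun x => by
      have := DFunLike.congr_fun h x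
      simpa [resolutionMap, hi, Nat.even_add_one, hν1, sub_eq_zero] using this
    have hinvj : ∀ j : ℕ, ∀ x, z ((σ ^ j) x) = z x := fun j x => by
      induction j with
      | zero => simp
      | succ j ih => rw [pow_succ', Equiv.Perm.mul_apply, hinv, ih]
    refine ⟨z.filter (fun x => s x = 0), ?_, ?_⟩
    · refine subset_trans (Finset.coe_subset.2 ?_) hz
      rw [Finsupp.support_filter]
      exact Finset.filter_subset _ _
    · ext x
      simp only [resolutionMap, hi, if_false, LinearMap.sum_apply, Finsupp.finsetSum_apply, hνj,
        Finsupp.filter_apply, hinvj]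
      by_cases hx : x ∈ S
      · rw [Finset.sum_eq_single (s x).val]
        · rw [hsj _ _ hx]
          simp
        · intro j hj hne
          rw [hsj _ _ hx, if_neg]
          intro h0
          apply hne
          rw [sub_eq_zero.1 h0, ZMod.val_natCast_of_lt (Finset.mem_range.1 hj)]
        · intro h0
          exact absurd (Finset.mem_range.2 (ZMod.val_lt (s x))) h0
      · simp [hzS x hx]

end FreeAction

section SignVectors

/-- Translating all the signs of a sign vector by one. -/
def shiftSigns {p : ℕ} (x : ℕ → Option (ZMod p)) : ℕ → Option (ZMod p) :=
  fun i => (x i).map (· + 1)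

/-- The order on sign vectors: `y` extends `x`. -/
def SignsLE {p : ℕ} (x y : ℕ → Option (ZMod p)) : Prop :=
  ∀ i a, x i = some a → y i = some a

/-- The sign vector `x` is nonzero and supported in `{1, …, n}`. -/
def SupportedIn {p : ℕ} (n : ℕ) (x : ℕ → Option (ZMod p)) : Prop :=
  (∃ i, x i ≠ none) ∧ ∀ i, x i ≠ none → i ∈ Finset.Icc 1 n

variable {p : ℕ}

lemma SignsLE.trans {x y z : ℕ → Option (ZMod p)} (h : SignsLE x y) (h' : SignsLE y z) :
    SignsLE x z := fun i a hi => h' i a (h i a hi)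

lemma SignsLE.ne_none {x y : ℕ → Option (ZMod p)} (h : SignsLE x y) {i : ℕ} (hi : x i ≠ none) :
    y i ≠ none := by
  obtain ⟨a, ha⟩ := Option.ne_none_iff_exists'.1 hi
  simp [h i a ha]

lemma shiftSigns_eq_none {x : ℕ → Option (ZMod p)} {i : ℕ} : shiftSigns x i = none ↔ x i = none := by
  simp [shiftSigns]

lemma shiftSigns_eq_some {x : ℕ → Option (ZMod p)} {i : ℕ} {a : ZMod p} :
    shiftSigns x i = some (a + 1) ↔ x i = some a := by
  simp [shiftSigns]

lemma SignsLE.shiftSigns {x y : ℕ → Option (ZMod p)} (h : SignsLE x y) :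
    SignsLE (shiftSigns x) (shiftSigns y) := by
  intro i a hi
  rw [← sub_add_cancel a 1, shiftSigns_eq_some] at hi ⊢
  exact h _ _ hi

lemma SupportedIn.shiftSigns {n : ℕ} {x : ℕ → Option (ZMod p)} (h : SupportedIn n x) :
    SupportedIn n (shiftSigns x) := by
  simpa only [SupportedIn, ne_eq, shiftSigns_eq_none] using h

lemma SupportedIn.mono {m n : ℕ} (hmn : m ≤ n) {x : ℕ → Option (ZMod p)} (h : SupportedIn m x) :
    SupportedIn n x :=
  ⟨h.1, fun i hi => Finset.Icc_subset_Icc_right hmn (h.2 i hi)⟩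

lemma shiftSigns_iterate (x : ℕ → Option (ZMod p)) (j : ℕ) :
    shiftSigns^[j] x = fun i => (x i).map (· + (j : ZMod p)) := by
  induction j with
  | zero => simp
  | succ j ih =>
    rw [Function.iterate_succ_apply', ih]
    funext i
    simp [shiftSigns, Function.comp_def, add_assoc]

/-- The chains of sign vectors supported in `{1, …, i + 1}`, of length `i + 1`. -/
def signChains (p i : ℕ) : Set (List (ℕ → Option (ZMod p))) :=
  {l | l.length = i + 1 ∧ l.Pairwise SignsLE ∧ ∀ x ∈ l, SupportedIn (i + 1) x}

open WordModule

lemma map_shiftSigns_pow :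
    (map shiftSigns : Module.End (ZMod p) (WordModule (ZMod p) (ℕ → Option (ZMod p)))) ^ p = 1 := by
  have h : ∀ (j : ℕ) (l : List (ℕ → Option (ZMod p))),
      ((map shiftSigns : Module.End (ZMod p) (WordModule (ZMod p) _)) ^ j)
        (Finsupp.single l 1) = Finsupp.single (l.map (shiftSigns^[j])) 1 := fun j l => by
    induction j with
    | zero => simp
    | succ j ih =>
      rw [pow_succ', Module.End.mul_apply, ih, map_single, List.map_map,
        Function.iterate_succ']
  have hp : (shiftSigns^[p] : (ℕ → Option (ZMod p)) → _) = id := by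
    funext x
    simp [shiftSigns_iterate]
  refine LinearMap.ext fun w => linear_ext (fun l => ?_) w
  simp [h, hp]

lemma map_shiftSigns_mem {i : ℕ} {w : WordModule (ZMod p) (ℕ → Option (ZMod p))}
    (hw : w ∈ Finsupp.supported (ZMod p) (ZMod p) (signChains p i)) :
    map shiftSigns w ∈ Finsupp.supported (ZMod p) (ZMod p) (signChains p i) := by
  refine map_mem ?_ hw
  rintro l ⟨h1, h2, h3⟩
  refine ⟨by simpa using h1, h2.map _ fun _ _ h => h.shiftSigns, fun x hx => ?_⟩
  obtain ⟨y, hy, rfl⟩ := List.mem_map.1 hx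
  exact (h3 y hy).shiftSigns

/-- Inserting the sign `0` at the position `j`. -/
def insertZero (j : ℕ) (x : ℕ → Option (ZMod p)) : ℕ → Option (ZMod p) :=
  Function.update x j (some 0)

lemma insertZero_mono (j : ℕ) {x y : ℕ → Option (ZMod p)} (h : SignsLE x y) :
    SignsLE (insertZero j x) (insertZero j y) := by
  intro i a hi
  by_cases hij : i = j
  · subst hij; simpa [insertZero] using hi
  · simp only [insertZero, Function.update_of_ne hij] at hi ⊢
    exact h i a hi

lemma SupportedIn.insertZero {i : ℕ} {x : ℕ → Option (ZMod p)} (hx : ∀ j, x j ≠ none → j ∈ Finset.Icc 1 i) :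
    SupportedIn (i + 1) (insertZero (i + 1) x) := by
  refine ⟨⟨i + 1, by simp [_root_.insertZero]⟩, fun j hj => ?_⟩
  by_cases hij : j = i + 1
  · simp [hij]
  · simp only [_root_.insertZero, Function.update_of_ne hij] at hj
    exact Finset.Icc_subset_Icc_right (Nat.le_succ i) (hx j hj)

lemma SupportedIn.le_insertZero {i : ℕ} {x : ℕ → Option (ZMod p)} (hx : SupportedIn i x) :
    SignsLE x (_root_.insertZero (i + 1) x) := by
  intro j a hj
  have := hx.2 j (by simp [hj])
  have hij : j ≠ i + 1 := by
    rintro rfl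
    simp at this
  simpa [_root_.insertZero, Function.update_of_ne hij] using hj

/-- Chains of sign vectors which map the periodic resolution of the cyclic group of order `p` to
the chains of the poset of sign vectors. -/
noncomputable def resolutionChain (p : ℕ) : ℕ → WordModule (ZMod p) (ℕ → Option (ZMod p))
  | 0 => Finsupp.single [insertZero 1 fun _ => none] 1
  | i + 1 => fill (insertZero (i + 2) fun _ => none) (insertZero (i + 2))
      (resolutionMap p (map shiftSigns) i (resolutionChain p i))

lemma resolutionChain_mem (i : ℕ) :
    resolutionChain p i ∈ Finsupp.supported (ZMod p) (ZMod p) (signChains p i) := by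
  induction i with
  | zero =>
    refine Finsupp.single_mem_supported _ _ ⟨rfl, List.pairwise_singleton _ _, fun x hx => ?_⟩
    rw [List.mem_singleton] at hx
    subst hx
    exact SupportedIn.insertZero (by simp)
  | succ i ih =>
    have hw := resolutionMap_apply_mem (p := p) (fun w hw => map_shiftSigns_mem hw) i ih
    refine Submodule.sub_mem _ ?_ ?_
    · refine cons_mem ?_ (map_mem (T := {l | l.length = i + 1 ∧ l.Pairwise SignsLE ∧
        ∀ x ∈ l, ∃ y, SupportedIn (i + 1) y ∧ x = insertZero (i + 2) y}) ?_ hw)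
      · rintro l ⟨h1, h2, h3⟩
        refine ⟨by simp [h1], List.pairwise_cons.2 ⟨fun x hx => ?_, h2⟩, fun x hx => ?_⟩
        · obtain ⟨y, hy, rfl⟩ := h3 x hx
          exact insertZero_mono _ fun i a h => by simp at h
        · rcases List.mem_cons.1 hx with rfl | hx
          · exact SupportedIn.insertZero (by simp)
          · obtain ⟨y, hy, rfl⟩ := h3 x hx
            exact SupportedIn.insertZero hy.2
      · rintro l ⟨h1, h2, h3⟩
        refine ⟨by simp [h1], h2.map _ fun _ _ h => insertZero_mono _ h, fun x hx => ?_⟩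
        obtain ⟨y, hy, rfl⟩ := List.mem_map.1 hx
        exact ⟨y, h3 y hy, rfl⟩
    · refine linearCombination_mem_supported ?_ hw
      rintro l ⟨h1, h2, h3⟩
      refine Finsupp.supported_mono ?_ (prismWord_mem (r := SignsLE) (good := SupportedIn (i + 1))
        (fun _ _ _ h h' => h.trans h') (fun _ _ h => insertZero_mono _ h)
        (fun _ h => h.le_insertZero) l h2 h3)
      rintro w ⟨h4, h5, h6⟩
      refine ⟨by rw [h4, h1], h5, fun x hx => ?_⟩
      obtain ⟨y, hy, rfl | rfl⟩ := h6 x hx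
      · exact (h3 _ hy).mono (by omega)
      · exact SupportedIn.insertZero (h3 y hy).2

lemma bd_resolutionMap (i : ℕ) (w : WordModule (ZMod p) (ℕ → Option (ZMod p))) :
    bd (resolutionMap p (map shiftSigns) i w) = resolutionMap p (map shiftSigns) i (bd w) :=
  resolutionMap_comm_of_comm (W := ⊤) (by simp) (fun w _ => bd_map _ w) i trivial

lemma bd_resolutionChain (i : ℕ) :
    bd (resolutionChain p (i + 1)) =
      resolutionMap p (map shiftSigns) i (resolutionChain p i) := by
  induction i with
  | zero =>
    refine bd_fill _ _ ?_
    rw [bd_resolutionMap]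
    simp [resolutionChain, resolutionMap, bdWord]
  | succ i ih =>
    refine bd_fill _ _ ?_
    rw [bd_resolutionMap, ih, ← Module.End.mul_apply, resolutionMap_mul_succ map_shiftSigns_pow,
      LinearMap.zero_apply]

lemma exists_not_isChain_ne {J : Type*} {l : List (J × ℕ)} {n : ℕ} (hl : l.length = n)
    (hn : 1 ≤ n)
    (hrk : ∀ x ∈ l, 1 ≤ x.2 ∧ x.2 < n)
    (hle : l.Pairwise fun x y => x.2 ≤ y.2 ∧ (x.2 = y.2 → x.1 = y.1)) :
    ¬ l.IsChain (· ≠ ·) := by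
  intro h
  have h1 : l.IsChain fun x y => x.2 < y.2 := by
    refine List.isChain_iff_getElem.2 fun i hi => ?_
    obtain ⟨h2, h3⟩ := List.isChain_iff_getElem.1 hle.isChain i hi
    exact lt_of_le_of_ne h2 fun h4 =>
      List.isChain_iff_getElem.1 h i hi (Prod.ext (h3 h4) h4)
  have h2 : (l.map Prod.snd).IsChain (· < ·) := (List.isChain_map _).2 h1
  have h3 : (l.map Prod.snd).Nodup := (List.isChain_iff_pairwise.1 h2).imp fun h => ne_of_lt h
  have h4 : (l.map Prod.snd).toFinset ⊆ Finset.Ico 1 n := by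
    intro a ha
    simp only [List.mem_toFinset, List.mem_map] at ha
    obtain ⟨x, hx, rfl⟩ := ha
    simpa using hrk x hx
  have h5 := Finset.card_le_card h4
  rw [List.toFinset_card_of_nodup h3, List.length_map, hl, Nat.card_Ico] at h5
  omega

/-- A version of the `ℤ_p`-Tucker lemma: an equivariant labelling of the nonzero sign vectors,
monotone for the lexicographic order, uses at least `n` ranks. -/
theorem tucker [Fact p.Prime] {n : ℕ} (hn : 1 ≤ n)
    (sg : (ℕ → Option (ZMod p)) → ZMod p) (rk : (ℕ → Option (ZMod p)) → ℕ)
    (hrk : ∀ x, SupportedIn n x → 1 ≤ rk x ∧ rk x < n)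
    (hmono : ∀ x y, SupportedIn n x → SupportedIn n y → SignsLE x y →
      rk x ≤ rk y ∧ (rk x = rk y → sg x = sg y))
    (hrks : ∀ x, SupportedIn n x → rk (shiftSigns x) = rk x)
    (hsgs : ∀ x, SupportedIn n x → sg (shiftSigns x) = sg x + 1) : False := by
  let lab : (ℕ → Option (ZMod p)) → ZMod p × ℕ := fun x => (sg x, rk x)
  let σ : Equiv.Perm (ZMod p × ℕ) := Equiv.prodCongr (Equiv.addRight 1) (Equiv.refl ℕ)
  let ν : Module.End (ZMod p) (WordModule (ZMod p) (ZMod p × ℕ)) := map σ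
  let b : Module.End (ZMod p) (WordModule (ZMod p) (ZMod p × ℕ)) := reduce ∘ₗ bd
  have hequiv : ∀ i < n, ∀ w ∈ Finsupp.supported (ZMod p) (ZMod p) (signChains p i),
      (reduce ∘ₗ map lab) (map shiftSigns w) = ν ((reduce ∘ₗ map lab) w) := by
    intro i hi w hw
    simp only [LinearMap.comp_apply, ν]
    rw [← reduce_map σ.injective]
    congr 1
    refine linear_ext_on (φ := map lab ∘ₗ map shiftSigns) (ψ := map σ ∘ₗ map lab) ?_ hw
    rintro l ⟨-, -, h⟩
    simp only [LinearMap.comp_apply, map_single, List.map_map]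
    congr 1
    refine List.map_congr_left fun x hx => ?_
    have hx' := (h x hx).mono hi
    simp [lab, σ, hrks x hx', hsgs x hx']
  refine ne_zero_of_exact (p := p) ν b ?_ ?_
    (fun i => Finsupp.supported (ZMod p) (ZMod p) (ofLength (ZMod p × ℕ) i)) ?_ ?_
    (Finsupp.lapply []) ?_ (fun i => (reduce ∘ₗ map lab) (resolutionChain p i)) ?_ (n - 1) ?_ ?_ ?_
  · refine LinearMap.ext fun w => ?_
    simp [b, ν, bd_map, reduce_map σ.injective]
  · refine LinearMap.ext fun w => ?_
    simp [b, reduce_bd_reduce, bd_bd]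
  · exact fun i w hw => reduce_mem (bd_mem hw)
  · intro i j z hz h
    refine exists_eq_resolutionMap (Equiv.listEquivOfEquiv σ) (ofLength _ (j + 1)) ?_
      (fun l => (l.headD (0, 0)).1) ?_ i z hz h
    · intro l
      simp [ofLength, Equiv.listEquivOfEquiv]
    · intro l hl
      rcases l with _ | ⟨x, l⟩
      · simp [ofLength] at hl
      · simp [Equiv.listEquivOfEquiv, σ]
  · refine linear_ext (φ := Finsupp.lapply [] ∘ₗ ν) (ψ := Finsupp.lapply []) fun l => ?_
    rcases l with _ | ⟨x, l⟩ <;> simp [ν]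
  · intro i
    refine reduce_mem (map_mem ?_ (resolutionChain_mem i))
    rintro l ⟨h, -⟩
    simpa [ofLength] using h
  · intro i hi
    rw [← resolutionMap_comm_of_comm (fun w hw => map_shiftSigns_mem hw) (hequiv i (by omega)) i
      (resolutionChain_mem i), ← bd_resolutionChain]
    simp [b, reduce_bd_reduce, bd_map]
  · have h1 : ∀ x : ZMod p × ℕ, reduce (Finsupp.single [x] (1 : ZMod p)) =
      Finsupp.single [x] 1 := fun x => reduce_of_isChain (by simp)
    have h2 : reduce (Finsupp.single ([] : List (ZMod p × ℕ)) (1 : ZMod p)) =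
      Finsupp.single [] 1 := reduce_of_isChain (by simp)
    simp [b, resolutionChain, h1, h2, bdWord]
  · refine linear_ext_on (φ := reduce ∘ₗ map lab) (ψ := 0) ?_ (resolutionChain_mem (n - 1))
    rintro l ⟨h1, h2, h3⟩
    rw [Nat.sub_add_cancel hn] at h1 h3
    rw [LinearMap.comp_apply, map_single, reduce_of_not_isChain, LinearMap.zero_apply]
    refine exists_not_isChain_ne (by simpa using h1) hn ?_ ?_
    · intro x hx
      obtain ⟨y, hy, rfl⟩ := List.mem_map.1 hx
      exact hrk y (h3 y hy)
    · rw [List.pairwise_map]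
      exact h2.imp_of_mem fun hx hy h => hmono _ _ (h3 _ hx) (h3 _ hy) h

end SignVectors

/-- `c` is constant on some edge of `KG^r([n] choose k)~_{s-stab}`. -/
def HasMonochromaticEdge (r n k s : ℕ) {t : ℕ} (c : Finset ℕ → Fin t) : Prop :=
  ∃ f : Fin r → Finset ℕ, (∀ i, f i ∈ V n k s) ∧ (∀ i j, i ≠ j → Disjoint (f i) (f j)) ∧
    ∃ a, ∀ i, c (f i) = a

/-- Every coloring of `KG^r([n] choose k)~_{s-stab}` with fewer than `(n - r (k - 1)) / (r - 1)`
colors has a monochromatic edge. -/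
def KneserBound (r s : ℕ) : Prop :=
  ∀ k n t : ℕ, 1 ≤ k → ∀ c : Finset ℕ → Fin t, r * (k - 1) + (r - 1) * t < n →
    HasMonochromaticEdge r n k s c

section Product

lemma exists_enumeration {s : ℕ} {A : Finset ℕ} (hA : stab s A) :
    ∃ e : ℕ → ℕ, (∀ i ∈ Finset.Icc 1 A.card, e i ∈ A) ∧
      (∀ i ∈ Finset.Icc 1 A.card, ∀ j ∈ Finset.Icc 1 A.card, i < j → e i < e j) ∧
      ∀ i ∈ Finset.Icc 1 A.card, ∀ d, i + d ∈ Finset.Icc 1 A.card → e i + d * s ≤ e (i + d) := by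
  classical
  have hfin : {i | i ∈ A}.Finite := A.finite_toSet
  have hcard : hfin.toFinset.card = A.card := by
    congr 1
    ext i
    exact hfin.mem_toFinset
  have hmem : ∀ i ∈ Finset.Icc 1 A.card, Nat.nth (· ∈ A) (i - 1) ∈ A := fun i hi => by
    rw [Finset.mem_Icc] at hi
    exact Nat.nth_mem_of_lt_card (p := (· ∈ A)) hfin (by omega)
  have hlt : ∀ i ∈ Finset.Icc 1 A.card, ∀ j ∈ Finset.Icc 1 A.card, i < j →
      Nat.nth (· ∈ A) (i - 1) < Nat.nth (· ∈ A) (j - 1) := fun i hi j hj hij => by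
    rw [Finset.mem_Icc] at hi hj
    exact Nat.nth_strictMonoOn (p := (· ∈ A)) hfin (by rw [Set.mem_Iio]; omega)
      (by rw [Set.mem_Iio]; omega) (by omega)
  refine ⟨fun i => Nat.nth (· ∈ A) (i - 1), hmem, hlt, fun i hi d => ?_⟩
  dsimp only
  induction d with
  | zero => simp
  | succ d ih =>
    intro hd
    have hd' : i + d ∈ Finset.Icc 1 A.card := by
      rw [Finset.mem_Icc] at hi hd ⊢
      omega
    have h1 := ih hd'
    have h2 := hlt _ hd' _ hd (by omega)
    have h3 := hA _ (hmem _ hd') _ (hmem _ hd) h2.ne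
    rw [Nat.succ_mul]
    omega

lemma HasMonochromaticEdge.lift {r n m k s₁ s₂ t : ℕ} {A : Finset ℕ} (hA : A ∈ V n m s₂)
    (c : Finset ℕ → Fin t)
    (h : ∀ c' : Finset ℕ → Fin t, HasMonochromaticEdge r m k s₁ c') :
    ∃ a, ∃ f : Fin r → Finset ℕ, (∀ i, f i ⊆ A) ∧ (∀ i, f i ∈ V n k (s₁ * s₂)) ∧
      (∀ i j, i ≠ j → Disjoint (f i) (f j)) ∧ ∀ i, c (f i) = a := by
  classical
  obtain ⟨hAn, hAm, hAs⟩ := hA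
  obtain ⟨e, he, hlt, hgap⟩ := exists_enumeration hAs
  rw [hAm] at he hlt hgap
  have hinj : Set.InjOn e (Finset.Icc 1 m) := by
    intro i hi j hj hij
    rcases lt_trichotomy i j with h | h | h
    · exact absurd hij (hlt i hi j hj h).ne
    · exact h
    · exact absurd hij (hlt j hj i hi h).ne'
  obtain ⟨f, hf, hdisj, a, ha⟩ := h fun S => c (S.image e)
  have hsub : ∀ i, (f i).image e ⊆ A := fun i =>
    Finset.image_subset_iff.2 fun x hx => he x ((hf i).1 hx)
  refine ⟨a, fun i => (f i).image e, hsub, fun i => ⟨(hsub i).trans hAn, ?_, ?_⟩, ?_, ha⟩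
  · rw [Finset.card_image_of_injOn (hinj.mono (Finset.coe_subset.2 (hf i).1)), (hf i).2.1]
  · have key : ∀ x ∈ f i, ∀ y ∈ f i, x + s₁ ≤ y → e x + s₁ * s₂ ≤ e y := fun x hx y hy hxy => by
      obtain ⟨d, rfl⟩ := Nat.exists_eq_add_of_le (le_of_add_le_left hxy)
      have h1 := hgap x ((hf i).1 hx) d ((hf i).1 hy)
      have h2 : s₁ * s₂ ≤ d * s₂ := Nat.mul_le_mul_right _ (by omega)
      omega
    intro x' hx' y' hy' hne
    obtain ⟨x, hx, rfl⟩ := Finset.mem_image.1 hx'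
    obtain ⟨y, hy, rfl⟩ := Finset.mem_image.1 hy'
    exact ((hf i).2.2 x hx y hy fun h => hne (by rw [h])).imp (key x hx y hy) (key y hy x hx)
  · intro i j hij
    rw [Finset.disjoint_left]
    intro x' hx' hy'
    obtain ⟨x, hx, rfl⟩ := Finset.mem_image.1 hx'
    obtain ⟨y, hy, hxy⟩ := Finset.mem_image.1 hy'
    have := hinj ((hf j).1 hy) ((hf i).1 hx) hxy
    subst this
    exact Finset.disjoint_left.1 (hdisj i j hij) hx hy

/-- The bound is multiplicative in the uniformity and in the stability parameter. -/
lemma KneserBound.mul {r₁ r₂ s₁ s₂ : ℕ} (hr₁ : 1 ≤ r₁) (hr₂ : 1 ≤ r₂) (h₁ : KneserBound r₁ s₁)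
    (h₂ : KneserBound r₂ s₂) : KneserBound (r₁ * r₂) (s₁ * s₂) := by
  classical
  intro k n t hk c hn
  set m := r₁ * (k - 1) + (r₁ - 1) * t + 1 with hm
  have hlift := fun (A : Finset ℕ) (hA : A ∈ V n m s₂) =>
    HasMonochromaticEdge.lift (k := k) (s₁ := s₁) hA c fun c' =>
      h₁ k m t hk c' (Nat.lt_succ_self _)
  have hbound : r₂ * (m - 1) + (r₂ - 1) * t < n := by
    refine lt_of_eq_of_lt ?_ hn
    obtain ⟨q₁, rfl⟩ := Nat.exists_eq_add_of_le' hr₁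
    obtain ⟨q₂, rfl⟩ := Nat.exists_eq_add_of_le' hr₂
    have : (q₁ + 1) * (q₂ + 1) - 1 = q₁ * q₂ + q₁ + q₂ := by
      rw [Nat.sub_eq_iff_eq_add (Nat.mul_pos (by omega) (by omega))]
      ring
    rw [this, hm]
    simp only [Nat.add_sub_cancel]
    ring
  obtain ⟨A, hA, hdisj, a, ha⟩ := h₂ m n t (by omega)
    (fun A => if h : A ∈ V n m s₂ then (hlift A h).choose else c ∅) hbound
  have hA' : ∀ j, ∃ f : Fin r₁ → Finset ℕ, (∀ i, f i ⊆ A j) ∧ (∀ i, f i ∈ V n k (s₁ * s₂)) ∧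
      (∀ i i', i ≠ i' → Disjoint (f i) (f i')) ∧ ∀ i, c (f i) = a := fun j => by
    have h := ha j
    dsimp only at h
    rw [dif_pos (hA j)] at h
    rw [← h]
    exact (hlift (A j) (hA j)).choose_spec
  choose f hfA hfV hfd hfc using hA'
  refine ⟨fun i => f (finProdFinEquiv.symm i).2 (finProdFinEquiv.symm i).1, fun i => hfV _ _, ?_,
    a, fun i => hfc _ _⟩
  intro i i' hne
  dsimp only
  have hne' := finProdFinEquiv.symm.injective.ne hne
  generalize finProdFinEquiv.symm i = x at hne'
  generalize finProdFinEquiv.symm i' = y at hne'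
  by_cases h : x.2 = y.2
  · rw [h]
    exact hfd _ _ _ fun h' => hne' (Prod.ext h' h)
  · exact (hdisj _ _ h).mono (hfA _ _) (hfA _ _)

lemma kneserBound_one (s : ℕ) (hs : s ≤ 1) : KneserBound 1 s := by
  intro k n t hk c hn
  refine ⟨fun _ => Finset.Icc 1 k, fun _ => ⟨Finset.Icc_subset_Icc_right (by omega), by simp, ?_⟩,
    fun i j hij => absurd (Subsingleton.elim i j) hij, _, fun _ => rfl⟩
  intro i _ j _ hij
  omega

end Product

section Coloring

lemma exists_isProperCol {n k r t : ℕ} (s : ℕ) (hk : 1 ≤ k) (hr : 2 ≤ r) (ht : 1 ≤ t)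
    (h : n ≤ r * (k - 1) + (r - 1) * t) :
    ∃ c : Finset ℕ → Fin t, IsProperCol r n k s t c := by
  classical
  refine ⟨fun S => ⟨min ((sInf (S : Set ℕ) - 1) / (r - 1)) (t - 1), by omega⟩, ?_⟩
  intro f hf hdisj
  by_contra! hcol
  simp only [Fin.mk.injEq] at hcol
  have hmin : ∀ i, sInf (f i : Set ℕ) ∈ f i := fun i => by
    have hne : (f i).Nonempty := Finset.card_pos.1 (by rw [(hf i).2.1]; exact hk)
    exact Finset.mem_coe.1 (Nat.sInf_mem (Finset.coe_nonempty.2 hne))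
  have hle : ∀ i, ∀ x ∈ f i, sInf (f i : Set ℕ) ≤ x := fun i x hx =>
    Nat.sInf_le (Finset.mem_coe.2 hx)
  have hpos : ∀ i, ∀ x ∈ f i, 1 ≤ x ∧ x ≤ n := fun i x hx => Finset.mem_Icc.1 ((hf i).1 hx)
  let i₀ : Fin r := ⟨0, by omega⟩
  by_cases hu : (sInf (f i₀ : Set ℕ) - 1) / (r - 1) < t - 1
  · set u := (sInf (f i₀ : Set ℕ) - 1) / (r - 1) with hu'
    have hall : ∀ i, (sInf (f i : Set ℕ) - 1) / (r - 1) = u := fun i => by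
      have := hcol i i₀
      omega
    have hinj : Function.Injective fun i => sInf (f i : Set ℕ) := by
      intro i j hij
      by_contra hne
      refine Finset.disjoint_left.1 (hdisj i j hne) (hmin i) ?_
      simp only at hij
      rw [hij]
      exact hmin j
    have hcard := Finset.card_le_card_of_injOn (s := Finset.univ)
      (t := Finset.Icc (u * (r - 1) + 1) (u * (r - 1) + (r - 1)))
      (fun i : Fin r => sInf (f i : Set ℕ)) (fun i _ => by
        have h1 := (Nat.div_eq_iff (by omega)).1 (hall i)
        have h2 := (hpos i _ (hmin i)).1
        simp only [Finset.coe_Icc, Set.mem_Icc]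
        omega) hinj.injOn
    simp at hcard
    omega
  · have hall : ∀ i, t - 1 ≤ (sInf (f i : Set ℕ) - 1) / (r - 1) := fun i => by
      have := hcol i i₀
      omega
    have hsub : Finset.univ.biUnion f ⊆ Finset.Icc ((t - 1) * (r - 1) + 1) n := by
      intro x hx
      obtain ⟨i, -, hx⟩ := Finset.mem_biUnion.1 hx
      have h1 := (Nat.le_div_iff_mul_le (by omega)).1 (hall i)
      have h2 := hle i x hx
      have h3 := hpos i x hx
      have h4 := hpos i _ (hmin i)
      rw [Finset.mem_Icc]
      omega
    have hcard := Finset.card_le_card hsub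
    rw [Finset.card_biUnion fun i _ j _ hij => hdisj i j hij,
      Finset.sum_congr rfl fun i _ => (hf i).2.1] at hcard
    simp only [Finset.sum_const, Finset.card_univ, Fintype.card_fin, smul_eq_mul,
      Nat.card_Icc] at hcard
    obtain ⟨k, rfl⟩ := Nat.exists_eq_add_of_le' hk
    obtain ⟨t, rfl⟩ := Nat.exists_eq_add_of_le' ht
    obtain ⟨r, rfl⟩ := Nat.exists_eq_add_of_le' hr
    have e : r + 2 - 1 = r + 1 := rfl
    simp only [Nat.add_sub_cancel, e] at hcard h
    have hcard' : (r + 2) * (k + 1) + t * (r + 1) ≤ n := by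
      have : 0 < (r + 2) * (k + 1) := by positivity
      omega
    nlinarith

end Coloring

section PrimeUniformity

variable {p : ℕ}

/-- No two consecutive integers in `S` carry the same sign. -/
def NoRepeatedSign (x : ℕ → Option (ZMod p)) (S : Finset ℕ) : Prop :=
  ∀ i ∈ S, x i ≠ none ∧ (i + 1 ∈ S → x i ≠ x (i + 1))

open Classical in
/-- The largest size of a set of nonzero positions without repeated consecutive signs. -/
noncomputable def alternation (n : ℕ) (x : ℕ → Option (ZMod p)) : ℕ :=
  ((Finset.Icc 1 n).powerset.filter (NoRepeatedSign x)).sup Finset.card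

/-- The first position of a nonzero sign. -/
noncomputable def firstPos (x : ℕ → Option (ZMod p)) : ℕ := sInf {i | x i ≠ none}

/-- The first nonzero sign. -/
noncomputable def firstSign (x : ℕ → Option (ZMod p)) : ZMod p := (x (firstPos x)).getD 0

/-- The positions of the sign `j`. -/
def signClass (n : ℕ) (x : ℕ → Option (ZMod p)) (j : ZMod p) : Finset ℕ :=
  (Finset.Icc 1 n).filter fun i => x i = some j

lemma card_le_alternation {n : ℕ} {x : ℕ → Option (ZMod p)} {S : Finset ℕ}
    (hS : S ⊆ Finset.Icc 1 n) (h : NoRepeatedSign x S) : S.card ≤ alternation n x := by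
  classical
  exact Finset.le_sup (f := Finset.card) (by simp [hS, h])

lemma exists_card_eq_alternation (n : ℕ) (x : ℕ → Option (ZMod p)) :
    ∃ S ⊆ Finset.Icc 1 n, NoRepeatedSign x S ∧ S.card = alternation n x := by
  classical
  obtain ⟨S, hS, h⟩ := Finset.exists_mem_eq_sup
    ((Finset.Icc 1 n).powerset.filter (NoRepeatedSign x)) ⟨∅, by simp [NoRepeatedSign]⟩ Finset.card
  rw [Finset.mem_filter, Finset.mem_powerset] at hS
  exact ⟨S, hS.1, hS.2, h.symm⟩

lemma noRepeatedSign_shiftSigns {x : ℕ → Option (ZMod p)} {S : Finset ℕ} :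
    NoRepeatedSign (shiftSigns x) S ↔ NoRepeatedSign x S := by
  have : ∀ i j, shiftSigns x i = shiftSigns x j ↔ x i = x j := fun i j =>
    (Option.map_injective (add_left_injective (1 : ZMod p))).eq_iff
  simp only [NoRepeatedSign, ne_eq, shiftSigns_eq_none, this]

lemma alternation_shiftSigns (n : ℕ) (x : ℕ → Option (ZMod p)) :
    alternation n (shiftSigns x) = alternation n x := by
  classical
  unfold alternation
  congr 1
  ext S
  rw [Finset.mem_filter, Finset.mem_filter, noRepeatedSign_shiftSigns]

lemma firstPos_mem {n : ℕ} {x : ℕ → Option (ZMod p)} (hx : SupportedIn n x) :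
    x (firstPos x) ≠ none :=
  Nat.sInf_mem (s := {i | x i ≠ none}) hx.1

lemma firstSign_spec {n : ℕ} {x : ℕ → Option (ZMod p)} (hx : SupportedIn n x) :
    x (firstPos x) = some (firstSign x) := by
  obtain ⟨a, ha⟩ := Option.ne_none_iff_exists'.1 (firstPos_mem hx)
  simp [firstSign, ha]

lemma firstSign_shiftSigns {n : ℕ} {x : ℕ → Option (ZMod p)} (hx : SupportedIn n x) :
    firstSign (shiftSigns x) = firstSign x + 1 := by
  have h : firstPos (shiftSigns x) = firstPos x := by
    simp only [firstPos, ne_eq, shiftSigns_eq_none]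
  have h1 := firstSign_spec hx.shiftSigns
  rw [h] at h1
  have h2 := shiftSigns_eq_some.2 (firstSign_spec hx)
  exact Option.some.inj (h1.symm.trans h2)

lemma NoRepeatedSign.of_signsLE {x y : ℕ → Option (ZMod p)} (h : SignsLE x y) {S : Finset ℕ}
    (hS : NoRepeatedSign x S) : NoRepeatedSign y S := by
  have hxy : ∀ i ∈ S, y i = x i := fun i hi => by
    obtain ⟨a, ha⟩ := Option.ne_none_iff_exists'.1 (hS i hi).1
    rw [ha, h i a ha]
  intro i hi
  refine ⟨by rw [hxy i hi]; exact (hS i hi).1, fun hi' => ?_⟩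
  rw [hxy i hi, hxy _ hi']
  exact (hS i hi).2 hi'

lemma alternation_mono {n : ℕ} {x y : ℕ → Option (ZMod p)} (h : SignsLE x y) :
    alternation n x ≤ alternation n y := by
  obtain ⟨S, hS, hx, hc⟩ := exists_card_eq_alternation n x
  rw [← hc]
  exact card_le_alternation hS (hx.of_signsLE h)

lemma one_le_alternation {n : ℕ} {x : ℕ → Option (ZMod p)} (hx : SupportedIn n x) :
    1 ≤ alternation n x := by
  rw [← Finset.card_singleton (firstPos x)]
  refine card_le_alternation (by simpa using hx.2 _ (firstPos_mem hx)) ?_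
  intro i hi
  rw [Finset.mem_singleton] at hi
  subst hi
  exact ⟨firstPos_mem hx, fun h => by simp at h⟩

lemma firstSign_eq_of_alternation_eq {n : ℕ} {x y : ℕ → Option (ZMod p)} (hx : SupportedIn n x)
    (hy : SupportedIn n y) (h : SignsLE x y) (heq : alternation n x = alternation n y) :
    firstSign x = firstSign y := by
  classical
  by_contra hne
  obtain ⟨S, hS, hxS, hc⟩ := exists_card_eq_alternation n x
  have hyx := h _ _ (firstSign_spec hx)
  have hyy := firstSign_spec hy
  have hle : firstPos y ≤ firstPos x := Nat.sInf_le (h.ne_none (firstPos_mem hx))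
  have hlt : firstPos y < firstPos x := by
    refine lt_of_le_of_ne hle fun h' => hne ?_
    rw [h', hyx] at hyy
    exact Option.some.inj hyy
  have hmin : ∀ i ∈ S, firstPos x ≤ i := fun i hi => Nat.sInf_le (hxS i hi).1
  have hnot : firstPos y ∉ S := fun hi => absurd (hmin _ hi) (not_le.2 hlt)
  have hyS := hxS.of_signsLE h
  have hins : NoRepeatedSign y (insert (firstPos y) S) := by
    intro i hi
    rcases Finset.mem_insert.1 hi with rfl | hi
    · refine ⟨firstPos_mem hy, fun hi' => ?_⟩
      have hi'' := (Finset.mem_insert.1 hi').resolve_left (by omega)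
      have : firstPos y + 1 = firstPos x := by
        have := hmin _ hi''
        omega
      rw [this, hyx, hyy]
      exact fun h' => hne (Option.some.inj h').symm
    · refine ⟨(hyS i hi).1, fun hi' => (hyS i hi).2 ((Finset.mem_insert.1 hi').resolve_left ?_)⟩
      have := hmin i hi
      omega
  have hcard := card_le_alternation (Finset.insert_subset (hy.2 _ (firstPos_mem hy)) hS) hins
  rw [Finset.card_insert_of_notMem hnot] at hcard
  omega

lemma exists_mem_V_of_lt_alternation [NeZero p] {n k : ℕ} {x : ℕ → Option (ZMod p)}
    (h : p * (k - 1) < alternation n x) : ∃ j, ∃ S ⊆ signClass n x j, S ∈ V n k 2 := by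
  classical
  obtain ⟨S, hS, hxS, hc⟩ := exists_card_eq_alternation n x
  obtain ⟨j, -, hj⟩ := Finset.exists_lt_card_fiber_of_mul_lt_card_of_maps_to (s := S)
    (t := (Finset.univ : Finset (ZMod p))) (f := fun i => (x i).getD 0) (n := k - 1)
    (fun _ _ => Finset.mem_univ _) (by rwa [Finset.card_univ, ZMod.card, hc])
  obtain ⟨T, hT, hTk⟩ := Finset.exists_subset_card_eq (Nat.le_of_pred_lt hj)
  have hTS : ∀ i ∈ T, i ∈ S ∧ x i = some j := fun i hi => by
    obtain ⟨h1, h2⟩ := Finset.mem_filter.1 (hT hi)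
    obtain ⟨a, ha⟩ := Option.ne_none_iff_exists'.1 (hxS i h1).1
    rw [ha, Option.getD_some] at h2
    exact ⟨h1, by rw [ha, h2]⟩
  have hadj : ∀ i ∈ T, i + 1 ∉ T := fun i hi hi' =>
    (hxS i (hTS i hi).1).2 (hTS _ hi').1 (by rw [(hTS i hi).2, (hTS _ hi').2])
  refine ⟨j, T, fun i hi => Finset.mem_filter.2 ⟨hS (hTS i hi).1, (hTS i hi).2⟩,
    fun i hi => hS (hTS i hi).1, hTk, ?_⟩
  intro a ha b hb hab
  have h1 : b ≠ a + 1 := fun h => hadj a ha (h ▸ hb)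
  have h2 : a ≠ b + 1 := fun h => hadj b hb (h ▸ ha)
  omega

open Classical in
/-- The signs `j` such that some stable `k`-set of positions of the sign `j` has color `a`. -/
noncomputable def colorSigns [NeZero p] (n k : ℕ) {t : ℕ} (c : Finset ℕ → Fin t)
    (x : ℕ → Option (ZMod p)) (a : Fin t) : Finset (ZMod p) :=
  Finset.univ.filter fun j => ∃ S ⊆ signClass n x j, S ∈ V n k 2 ∧ c S = a

lemma mem_colorSigns [NeZero p] {n k t : ℕ} {c : Finset ℕ → Fin t} {x : ℕ → Option (ZMod p)}
    {a : Fin t} {j : ZMod p} :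
    j ∈ colorSigns n k c x a ↔ ∃ S ⊆ signClass n x j, S ∈ V n k 2 ∧ c S = a := by
  simp [colorSigns]

lemma colorSigns_mono [NeZero p] {n k t : ℕ} {c : Finset ℕ → Fin t} {x y : ℕ → Option (ZMod p)}
    (h : SignsLE x y) (a : Fin t) : colorSigns n k c x a ⊆ colorSigns n k c y a := by
  intro j hj
  obtain ⟨S, hS, h'⟩ := mem_colorSigns.1 hj
  refine mem_colorSigns.2 ⟨S, fun i hi => ?_, h'⟩
  obtain ⟨h1, h2⟩ := Finset.mem_filter.1 (hS hi)
  exact Finset.mem_filter.2 ⟨h1, h _ _ h2⟩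

lemma colorSigns_shiftSigns [NeZero p] (n k : ℕ) {t : ℕ} (c : Finset ℕ → Fin t)
    (x : ℕ → Option (ZMod p)) (a : Fin t) :
    colorSigns n k c (shiftSigns x) a =
      (colorSigns n k c x a).map (Equiv.addRight 1).toEmbedding := by
  ext j
  have : signClass n (shiftSigns x) j = signClass n x (j - 1) := by
    ext i
    rw [signClass, signClass, Finset.mem_filter, Finset.mem_filter,
      ← shiftSigns_eq_some (x := x), sub_add_cancel]
  rw [mem_colorSigns, this, ← mem_colorSigns, Finset.mem_map_equiv]
  simp [sub_eq_add_neg]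

lemma card_colorSigns_le [NeZero p] {n k t : ℕ} {c : Finset ℕ → Fin t}
    (h : ¬ HasMonochromaticEdge p n k 2 c) (x : ℕ → Option (ZMod p)) (a : Fin t) :
    (colorSigns n k c x a).card ≤ p - 1 := by
  by_contra! hlt
  have hcard : (colorSigns n k c x a).card = Fintype.card (ZMod p) := by
    have := Finset.card_le_univ (colorSigns n k c x a)
    rw [ZMod.card] at this ⊢
    omega
  have huniv := (Finset.card_eq_iff_eq_univ _).1 hcard
  have hS : ∀ j : ZMod p, ∃ S ⊆ signClass n x j, S ∈ V n k 2 ∧ c S = a := fun j =>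
    mem_colorSigns.1 (huniv ▸ Finset.mem_univ j)
  choose S hSx hSV hSc using hS
  let e := (Fintype.equivFinOfCardEq (ZMod.card p)).symm
  refine h ⟨fun i => S (e i), fun i => hSV _, fun i j hij => ?_, a, fun i => hSc _⟩
  rw [Finset.disjoint_left]
  intro m hm hm'
  have h1 := (Finset.mem_filter.1 (hSx _ hm)).2
  rw [(Finset.mem_filter.1 (hSx _ hm')).2] at h1
  exact hij (e.injective (Option.some.inj h1).symm)

/-- The barycenter of a set of signs. -/
noncomputable def barycenter (G : Finset (ZMod p)) : ZMod p := (∑ j ∈ G, j) * (G.card : ZMod p)⁻¹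

lemma barycenter_map_addRight [Fact p.Prime] {G : Finset (ZMod p)} (h0 : G.card ≠ 0)
    (hG : G.card < p) :
    barycenter (G.map (Equiv.addRight 1).toEmbedding) = barycenter G + 1 := by
  have : (G.card : ZMod p) ≠ 0 := fun h =>
    Nat.not_dvd_of_pos_of_lt (Nat.pos_of_ne_zero h0) hG ((ZMod.natCast_eq_zero_iff _ _).1 h)
  simp only [barycenter, Finset.sum_map, Finset.card_map, Equiv.coe_toEmbedding,
    Equiv.coe_addRight, Finset.sum_add_distrib, Finset.sum_const, nsmul_eq_mul, mul_one]
  field_simp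

/-- The bound for almost `2`-stable Kneser hypergraphs of prime uniformity. -/
theorem kneserBound_prime [hp : Fact p.Prime] : KneserBound p 2 := by
  classical
  intro k n t hk c hn
  by_contra hmono
  have hp1 : 1 ≤ p := hp.out.one_lt.le
  obtain ⟨pick, hpick⟩ : ∃ pick : (Fin t → ℕ) → Fin t, ∀ g : Fin t → ℕ,
      (∃ a, g a ≠ 0) → g (pick g) ≠ 0 := by
    refine ⟨fun g => if h : ∃ a, g a ≠ 0 then h.choose else c ∅, fun g h => ?_⟩
    simp only [dif_pos h]
    exact h.choose_spec
  let F : (ℕ → Option (ZMod p)) → Fin t → Finset (ZMod p) := colorSigns n k c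
  let size : (ℕ → Option (ZMod p)) → Fin t → ℕ := fun x a => (F x a).card
  have hsize : ∀ x, size (shiftSigns x) = size x := fun x => by
    funext a
    simp only [size, F, colorSigns_shiftSigns, Finset.card_map]
  have hle : ∀ x a, size x a ≤ p - 1 := fun x a => card_colorSigns_le hmono x a
  have hne : ∀ x, p * (k - 1) < alternation n x → ∃ a, size x a ≠ 0 := fun x hx => by
    obtain ⟨j, S, hS, hV⟩ := exists_mem_V_of_lt_alternation hx
    exact ⟨c S, Finset.card_ne_zero_of_mem (mem_colorSigns.2 ⟨S, hS, hV, rfl⟩)⟩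
  have hsum : ∀ x, ∑ a, size x a ≤ (p - 1) * t := fun x => by
    refine (Finset.sum_le_card_nsmul _ _ _ fun a _ => hle x a).trans ?_
    simp [mul_comm]
  refine tucker (p := p) (n := n) (by omega)
    (fun x => if alternation n x ≤ p * (k - 1) then firstSign x
      else barycenter (F x (pick (size x))))
    (fun x => if alternation n x ≤ p * (k - 1) then alternation n x
      else p * (k - 1) + ∑ a, size x a) ?_ ?_ ?_ ?_
  · intro x hx
    split_ifs with h
    · exact ⟨one_le_alternation hx, by omega⟩
    · obtain ⟨a, ha⟩ := hne x (not_le.1 h)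
      have h1 := Finset.single_le_sum (f := size x) (fun _ _ => Nat.zero_le _) (Finset.mem_univ a)
      have h2 := hsum x
      omega
  · intro x y hx hy hxy
    have halt := alternation_mono (n := n) hxy
    by_cases h : alternation n y ≤ p * (k - 1)
    · rw [if_pos (halt.trans h), if_pos h, if_pos (halt.trans h), if_pos h]
      exact ⟨halt, firstSign_eq_of_alternation_eq hx hy hxy⟩
    · rw [if_neg h, if_neg h]
      obtain ⟨a, ha⟩ := hne y (not_le.1 h)
      have h1 := Finset.single_le_sum (f := size y) (fun _ _ => Nat.zero_le _) (Finset.mem_univ a)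
      by_cases h' : alternation n x ≤ p * (k - 1)
      · rw [if_pos h', if_pos h']
        exact ⟨by omega, by omega⟩
      · rw [if_neg h', if_neg h']
        have hsub : ∀ a, size x a ≤ size y a := fun a =>
          Finset.card_le_card (colorSigns_mono hxy a)
        refine ⟨Nat.add_le_add_left (Finset.sum_le_sum fun a _ => hsub a) _, fun heq => ?_⟩
        have heq' := (Finset.sum_eq_sum_iff_of_le fun a _ => hsub a).1 (Nat.add_left_cancel heq)
        have hF : F x = F y := funext fun a =>
          Finset.eq_of_subset_of_card_le (colorSigns_mono hxy a) (heq' a (Finset.mem_univ a)).ge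
        simp only [size, hF]
  · intro x hx
    simp only [alternation_shiftSigns, hsize]
  · intro x hx
    simp only [alternation_shiftSigns, hsize]
    split_ifs with h
    · exact firstSign_shiftSigns hx
    · have h0 := hpick _ (hne x (not_le.1 h))
      have h1 := hle x (pick (size x))
      simp only [F, colorSigns_shiftSigns]
      exact barycenter_map_addRight h0 (h1.trans_lt (Nat.sub_lt hp1 one_pos))

end PrimeUniformity

/-- The bound for arbitrary uniformity. -/
theorem kneserBound {r : ℕ} (hr : 1 ≤ r) : KneserBound r (2 ^ r.primeFactorsList.length) := by
  induction r using induction_on_primes with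
  | zero => omega
  | one => exact kneserBound_one _ (by simp)
  | prime_mul q r hq ih =>
    have hr' : 1 ≤ r := Nat.pos_of_mul_pos_left hr
    have : Fact q.Prime := ⟨hq⟩
    have hlen : (q * r).primeFactorsList.length = 1 + r.primeFactorsList.length := by
      rw [(Nat.perm_primeFactorsList_mul hq.ne_zero (by omega)).length_eq, List.length_append,
        Nat.primeFactorsList_prime hq, List.length_singleton]
    rw [hlen, pow_add, pow_one]
    exact KneserBound.mul hq.one_lt.le hr' kneserBound_prime (ih hr')

/-- For `n ≥ rk` (with `r ≥ 2`), the chromatic number of the almost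
`2^{μ(r)}`-stable Kneser hypergraph `KG^r([n] choose k)~_{2^{μ(r)}-stab}` equals
`⌈(n-(k-1)r)/(r-1)⌉`, where `μ(r)` is the number of prime divisors of `r` counted
with multiplicity. -/
theorem stmt_13 (n k r : ℕ) (hk : 1 ≤ k) (hr : 2 ≤ r) (hn : r * k ≤ n) :
    IsLeast {t : ℕ | ∃ c : Finset ℕ → Fin t,
        IsProperCol r n k (2 ^ r.primeFactorsList.length) t c}
      (⌈((n : ℚ) - ((k : ℚ) - 1) * r) / ((r : ℚ) - 1)⌉.toNat) := by
  have hr1 : (0 : ℚ) < (r : ℚ) - 1 := by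
    have : (2 : ℚ) ≤ r := by exact_mod_cast hr
    linarith
  have hcast : ∀ t : ℕ, ((r * (k - 1) + (r - 1) * t : ℕ) : ℚ) =
      ((k : ℚ) - 1) * r + t * ((r : ℚ) - 1) := fun t => by
    rw [Nat.cast_add, Nat.cast_mul, Nat.cast_mul, Nat.cast_sub hk, Nat.cast_sub (by omega)]
    push_cast
    ring
  constructor
  · refine exists_isProperCol _ hk hr ?_ ?_
    · rw [Nat.one_le_iff_ne_zero, ← Nat.pos_iff_ne_zero, Int.lt_toNat, Nat.cast_zero, Int.ceil_pos]
      refine div_pos ?_ hr1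
      have h1 : ((r * k : ℕ) : ℚ) ≤ n := by exact_mod_cast hn
      push_cast at h1
      nlinarith
    · rw [← Nat.cast_le (α := ℚ), hcast]
      have h1 := Int.le_ceil (((n : ℚ) - ((k : ℚ) - 1) * r) / ((r : ℚ) - 1))
      have h2 : ((⌈((n : ℚ) - ((k : ℚ) - 1) * r) / ((r : ℚ) - 1)⌉ : ℤ) : ℚ) ≤
          ((⌈((n : ℚ) - ((k : ℚ) - 1) * r) / ((r : ℚ) - 1)⌉.toNat : ℕ) : ℚ) := by
        exact_mod_cast Int.self_le_toNat _
      have h3 := (div_le_iff₀ hr1).1 (h1.trans h2)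
      linarith
  · rintro t ⟨c, hc⟩
    by_contra! hlt
    rw [Int.lt_toNat, Int.lt_ceil, lt_div_iff₀ hr1] at hlt
    obtain ⟨f, hf, hdisj, a, ha⟩ := kneserBound (r := r) (by omega) k n t hk c (by
      rw [← Nat.cast_lt (α := ℚ), hcast]
      push_cast at hlt
      linarith)
    obtain ⟨i, j, hij⟩ := hc f hf hdisj
    exact hij (by rw [ha, ha])
end

section
/- (Schrijver's theorem, lower bound via Tucker's lemma) For n ≥ 2k, the Schrijver graph KG^2([n] choose k)_{2-stab}, whose vertices are the 2-stable k-subsets of [n] (no two elements consecutive, including 1 and n considered consecutive) and whose edges join disjoint such sets, has chromatic number at least n - 2k + 2. -/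
/-- `S ⊆ [n]` is `2`-stable on the `n`-cycle: for all distinct `i, j ∈ S`,
`2 ≤ |i-j| ≤ n-2`. -/
def CycStab2 (n : ℕ) (S : Finset ℕ) : Prop :=
  ∀ i ∈ S, ∀ j ∈ S, i < j → i + 2 ≤ j ∧ j ≤ i + n - 2

/-- A vertex of the Schrijver graph `KG^2([n] choose k)_{2-stab}`: a `2`-stable
`k`-subset of `[n] = {1,…,n}`. -/
def SchrijverVertex (n k : ℕ) (S : Finset ℕ) : Prop :=
  S ⊆ Finset.Icc 1 n ∧ S.card = k ∧ CycStab2 n S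

namespace Tucker

/-- Sign vectors indexed by `ℕ`; the ones of interest have finite support. -/
abbrev SignVec := ℕ → SignType

/-- `Y` extends `X`: the two agree on the support of `X`. -/
def Extends (X Y : SignVec) : Prop := ∀ i, X i ≠ 0 → Y i = X i

theorem Extends.trans {X Y Z : SignVec} (h : Extends X Y) (h' : Extends Y Z) :
    Extends X Z := fun i hi => by
  rw [h' i (by rwa [h i hi]), h i hi]

theorem Extends.neg {X Y : SignVec} (h : Extends X Y) : Extends (-X) (-Y) := fun i hi => by
  have : X i ≠ 0 := fun h0 => hi (by simp [h0])
  simp [h i this]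

/-- The nonzero sign vectors supported on `{0, …, d - 1}`. -/
def IsVertex (d : ℕ) (X : SignVec) : Prop := X ≠ 0 ∧ ∀ i, d ≤ i → X i = 0

theorem IsVertex.neg {d : ℕ} {X : SignVec} (h : IsVertex d X) : IsVertex d (-X) :=
  ⟨fun h0 => h.1 (funext fun i => by simpa using congrFun h0 i),
    fun i hi => by simp [h.2 i hi]⟩

theorem IsVertex.mono {d e : ℕ} {X : SignVec} (h : IsVertex d X) (hde : d ≤ e) :
    IsVertex e X := ⟨h.1, fun i hi => h.2 i (hde.trans hi)⟩

/-- The vector `X` with its entry at `e` set to `1`. -/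
def join (e : ℕ) (X : SignVec) : SignVec := Function.update X e 1

theorem isVertex_join {d : ℕ} {X : SignVec} (h : ∀ i, d ≤ i → X i = 0) :
    IsVertex (d + 1) (join d X) := by
  refine ⟨fun h0 => ?_, fun i hi => ?_⟩
  · have := congrFun h0 d
    simp [join] at this
  · rw [join, Function.update_of_ne (by omega), h i (by omega)]

theorem extends_join {d : ℕ} {X : SignVec} (h : X d = 0) : Extends X (join d X) := by
  intro i hi
  rw [join, Function.update_of_ne (by rintro rfl; exact hi h)]

theorem Extends.join {X Y : SignVec} (h : Extends X Y) (d : ℕ) :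
    Extends (join d X) (join d Y) := by
  intro i hi
  by_cases hid : i = d
  · subst hid; simp [Tucker.join]
  · simp only [Tucker.join, Function.update_of_ne hid] at hi ⊢
    exact h i hi

section Cochains

variable {V W : Type*}

/-- The simplicial coboundary modulo `2` of a cochain on ordered simplices. -/
def coboundary (φ : List V → ZMod 2) : List V → ZMod 2
  | [] => 0
  | x :: l => φ l + coboundary (fun l' => φ (x :: l')) l

theorem coboundary_add (φ ψ : List V → ZMod 2) (l : List V) :
    coboundary (fun l' => φ l' + ψ l') l = coboundary φ l + coboundary ψ l := by
  induction l generalizing φ ψ with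
  | nil => simp [coboundary]
  | cons x l ih => simp only [coboundary, ih]; ring

theorem coboundary_const_mul (a : ZMod 2) (φ : List V → ZMod 2) (l : List V) :
    coboundary (fun l' => a * φ l') l = a * coboundary φ l := by
  induction l generalizing φ with
  | nil => simp [coboundary]
  | cons x l ih => simp only [coboundary, ih]; ring

theorem coboundary_map (g : V → W) (φ : List W → ZMod 2) (l : List V) :
    coboundary (fun l' => φ (l'.map g)) l = coboundary φ (l.map g) := by
  induction l generalizing φ with
  | nil => simp [coboundary]
  | cons x l ih =>
    simp only [coboundary, List.map_cons]
    rw [ih (fun l' => φ (g x :: l'))]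

theorem coboundary_congr {φ ψ : List V → ZMod 2} {l : List V}
    (h : ∀ l', l'.Sublist l → φ l' = ψ l') : coboundary φ l = coboundary ψ l := by
  induction l generalizing φ ψ with
  | nil => rfl
  | cons x l ih =>
    simp only [coboundary]
    rw [h l (List.sublist_cons_self x l), ih fun l' hl' => h _ (hl'.cons_cons x)]

theorem coboundary_perm {φ : List V → ZMod 2} (hφ : ∀ l l', l.Perm l' → φ l = φ l')
    {l l' : List V} (h : l.Perm l') : coboundary φ l = coboundary φ l' := by
  induction h generalizing φ with
  | nil => rfl
  | cons x h ih =>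
    simp only [coboundary]
    rw [hφ _ _ h, ih fun a b hab => hφ _ _ (hab.cons x)]
  | swap x y l =>
    simp only [coboundary]
    rw [coboundary_congr (φ := fun l' => φ (y :: x :: l')) (ψ := fun l' => φ (x :: y :: l'))
      fun l' _ => hφ _ _ (List.Perm.swap x y l')]
    ring
  | trans _ _ ih₁ ih₂ => exact (ih₁ hφ).trans (ih₂ hφ)

end Cochains

/-- The dual of the prism operator between the identity and `join e`: for `l = [X₁, …, Xₖ]` and
`X₀ = y`, the sum of the values of `φ` at `[X₁, …, Xᵢ, join e Xᵢ, …, join e Xₖ]`, `0 ≤ i ≤ k`. -/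
def prism (e : ℕ) (φ : List SignVec → ZMod 2) (y : SignVec) : List SignVec → ZMod 2
  | [] => φ [join e y]
  | x :: l => φ (join e y :: (x :: l).map (join e)) + prism e (fun l' => φ (x :: l')) x l

theorem prism_add (e : ℕ) (φ ψ : List SignVec → ZMod 2) (y : SignVec) (l : List SignVec) :
    prism e (fun l' => φ l' + ψ l') y l = prism e φ y l + prism e ψ y l := by
  induction l generalizing φ ψ y with
  | nil => simp [prism]
  | cons x l ih => simp only [prism, ih]; ring

theorem prism_base_change (e : ℕ) (φ : List SignVec → ZMod 2) (x y : SignVec)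
    (l : List SignVec) :
    prism e φ y l + φ (join e x :: l.map (join e)) =
      prism e φ x l + φ (join e y :: l.map (join e)) := by
  cases l with
  | nil => simp only [prism, List.map_nil]; ring
  | cons z l => simp only [prism]; ring

theorem prism_coboundary (e : ℕ) (φ : List SignVec → ZMod 2) (y : SignVec)
    (l : List SignVec) :
    prism e (coboundary φ) y l = φ l + coboundary (prism e φ y) l := by
  induction l generalizing φ y with
  | nil => simp [prism, coboundary]
  | cons x l ih =>
    have h1 := prism_add e φ (coboundary fun l' => φ (x :: l')) x l
    have h2 := prism_base_change e φ x y l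
    have h3 := coboundary_map (join e) (fun l' => φ (join e y :: join e x :: l')) l
    have h4 := coboundary_add (fun l' => φ (join e y :: join e x :: l'.map (join e)))
      (prism e (fun l' => φ (x :: l')) x) l
    simp only [prism, coboundary, List.map_cons] at h3 h4 ⊢
    rw [h4, h3, h1, ih]
    have two : (2 : ZMod 2) = 0 := rfl
    linear_combination -h2 + (φ (join e x :: l.map (join e))) * two

theorem prism_congr {d : ℕ} {φ ψ : List SignVec → ZMod 2} {y : SignVec} {l : List SignVec}
    (hy : ∀ i, d ≤ i → y i = 0) (hl : ∀ X ∈ l, IsVertex d X) (hyl : ∀ X ∈ l, Extends y X)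
    (hp : l.Pairwise Extends)
    (h : ∀ l' : List SignVec, l'.length = l.length + 1 → l'.Pairwise Extends →
      (∀ X ∈ l', IsVertex (d + 1) X) → (∀ X ∈ l', Extends y X) → φ l' = ψ l') :
    prism d φ y l = prism d ψ y l := by
  induction l generalizing φ ψ y with
  | nil =>
    refine h _ rfl (List.pairwise_singleton _ _) ?_ ?_
    · simpa using isVertex_join hy
    · simpa using extends_join (hy d le_rfl)
  | cons x l ih =>
    have hx := hl x List.mem_cons_self
    have hyx := hyl x List.mem_cons_self
    rw [List.pairwise_cons] at hp
    simp only [prism]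
    congr 1
    · refine h _ (by simp) ?_ ?_ ?_
      · rw [List.pairwise_cons]
        constructor
        · intro X hX
          obtain ⟨Z, hZ, rfl⟩ := List.mem_map.mp hX
          exact (hyl Z hZ).join d
        · rw [List.pairwise_map]
          exact (List.pairwise_cons.mpr hp).imp fun h => h.join d
      · intro X hX
        rcases List.mem_cons.mp hX with rfl | hX
        · exact isVertex_join hy
        · obtain ⟨Z, hZ, rfl⟩ := List.mem_map.mp hX
          exact isVertex_join (hl Z hZ).2
      · intro X hX
        rcases List.mem_cons.mp hX with rfl | hX
        · exact extends_join (hy d le_rfl)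
        · obtain ⟨Z, hZ, rfl⟩ := List.mem_map.mp hX
          exact (hyl Z hZ).trans (extends_join ((hl Z hZ).2 d le_rfl))
    · refine ih hx.2 (fun X hX => hl X (List.mem_cons_of_mem _ hX)) hp.1 hp.2 ?_
      intro l' hlen hp' hv hx'
      refine h _ (by simp [hlen]) (List.pairwise_cons.mpr ⟨hx', hp'⟩) ?_ ?_
      · intro X hX
        rcases List.mem_cons.mp hX with rfl | hX
        · exact hx.mono (Nat.le_succ d)
        · exact hv X hX
      · intro X hX
        rcases List.mem_cons.mp hX with rfl | hX
        · exact hyx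
        · exact hyx.trans (hx' X hX)

/-- Evaluation of a cochain on the fundamental cycle modulo `2` of the barycentric subdivision of
the boundary of the `d`-dimensional cross-polytope. -/
def sphereEval : ℕ → (List SignVec → ZMod 2) → ZMod 2
  | 0, φ => φ []
  | d + 1, φ => sphereEval d (prism d φ 0) +
      sphereEval d (prism d (fun l => φ (l.map Neg.neg)) 0)

/-- The full flags of sign vectors supported on `{0, …, d - 1}`. -/
def IsFlag (d : ℕ) (l : List SignVec) : Prop :=
  l.length = d ∧ l.Pairwise Extends ∧ ∀ X ∈ l, IsVertex d X

theorem IsFlag.neg {d : ℕ} {l : List SignVec} (h : IsFlag d l) : IsFlag d (l.map Neg.neg) := by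
  refine ⟨by simp [h.1], ?_, ?_⟩
  · rw [List.pairwise_map]
    exact h.2.1.imp Extends.neg
  · intro X hX
    obtain ⟨Z, hZ, rfl⟩ := List.mem_map.mp hX
    exact (h.2.2 Z hZ).neg

theorem prism_congr_of_isFlag {d : ℕ} {φ ψ : List SignVec → ZMod 2}
    (h : ∀ l, IsFlag (d + 1) l → φ l = ψ l) {l : List SignVec} (hl : IsFlag d l) :
    prism d φ 0 l = prism d ψ 0 l :=
  prism_congr (fun _ _ => rfl) hl.2.2 (fun _ _ _ hi => absurd rfl hi) hl.2.1
    fun l' hlen hp hv _ => h l' ⟨by rw [hlen, hl.1], hp, hv⟩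

theorem sphereEval_congr {d : ℕ} {φ ψ : List SignVec → ZMod 2}
    (h : ∀ l, IsFlag d l → φ l = ψ l) : sphereEval d φ = sphereEval d ψ := by
  induction d generalizing φ ψ with
  | zero => exact h [] ⟨rfl, List.Pairwise.nil, by simp⟩
  | succ d ih =>
    simp only [sphereEval]
    rw [ih fun l hl => prism_congr_of_isFlag h hl,
      ih fun l hl => prism_congr_of_isFlag (fun l' hl' => h _ hl'.neg) hl]

theorem sphereEval_add (d : ℕ) (φ ψ : List SignVec → ZMod 2) :
    sphereEval d (fun l => φ l + ψ l) = sphereEval d φ + sphereEval d ψ := by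
  induction d generalizing φ ψ with
  | zero => rfl
  | succ d ih =>
    simp only [sphereEval]
    have h1 := funext fun l => prism_add d φ ψ 0 l
    have h2 := funext fun l =>
      prism_add d (fun l => φ (l.map Neg.neg)) (fun l => ψ (l.map Neg.neg)) 0 l
    rw [h1, h2, ih, ih]
    ring

theorem sphereEval_neg (d : ℕ) (φ : List SignVec → ZMod 2) :
    sphereEval d (fun l => φ (l.map Neg.neg)) = sphereEval d φ := by
  cases d with
  | zero => rfl
  | succ d =>
    simp only [sphereEval, List.map_map]
    rw [add_comm]
    simp

theorem sphereEval_coboundary (d : ℕ) (φ : List SignVec → ZMod 2) :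
    sphereEval d (coboundary φ) = 0 := by
  induction d generalizing φ with
  | zero => rfl
  | succ d ih =>
    have h : (fun l : List SignVec => coboundary φ (l.map Neg.neg)) =
        coboundary fun l => φ (l.map Neg.neg) :=
      funext fun l => (coboundary_map Neg.neg φ l).symm
    have key (ψ : List SignVec → ZMod 2) :
        sphereEval d (prism d (coboundary ψ) 0) = sphereEval d ψ := by
      rw [funext fun l => prism_coboundary d ψ 0 l, sphereEval_add, ih, add_zero]
    simp only [sphereEval]
    rw [h, key, key, sphereEval_neg]
    exact CharTwo.add_self_eq_zero _

theorem sphereEval_succ_of_coboundary {d : ℕ} {φ : List SignVec → ZMod 2}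
    (h : ∀ l, IsFlag (d + 1) l → φ l + φ (l.map Neg.neg) = coboundary φ l) :
    sphereEval (d + 1) φ = sphereEval d φ := by
  simp only [sphereEval]
  rw [← sphereEval_add, ← funext fun l => prism_add d φ (fun l => φ (l.map Neg.neg)) 0 l,
    sphereEval_congr fun l hl => prism_congr_of_isFlag h hl,
    funext fun l => prism_coboundary d φ 0 l, sphereEval_add, sphereEval_coboundary, add_zero]

/-- The indicator of the lists whose parities alternate, `b` telling whether the head is odd. -/
def alternating : Bool → List ℕ → ZMod 2
  | _, [] => 1
  | b, x :: l => (if x.bodd = b then 1 else 0) * alternating (!b) l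

theorem coboundary_alternating (b : Bool) (l : List ℕ) :
    coboundary (alternating b) l = alternating b l + alternating (!b) l := by
  induction l generalizing b with
  | nil => rfl
  | cons x l ih =>
    have two : (2 : ZMod 2) = 0 := rfl
    simp only [coboundary, alternating, coboundary_const_mul, ih, Bool.not_not]
    cases b <;> cases x.bodd <;> simp <;> linear_combination (alternating _ l) * two

/-- `2 * j` and `2 * j + 1`, which encode opposite labels of absolute value `j`, are swapped. -/
def opposite (x : ℕ) : ℕ := if x.bodd then x - 1 else x + 1

/-- No two entries of `l` are opposite labels. -/
def Compatible (l : List ℕ) : Prop := ∀ x ∈ l, ∀ y ∈ l, x / 2 = y / 2 → x = y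

theorem bodd_opposite (x : ℕ) : (opposite x).bodd = !x.bodd := by
  unfold opposite
  cases x with
  | zero => simp
  | succ x => split_ifs with h <;> simp at h ⊢

theorem opposite_div_two (x : ℕ) : opposite x / 2 = x / 2 := by
  have h := Nat.mod_two_of_bodd x
  unfold opposite
  split_ifs with hx <;> simp [hx] at h <;> omega

theorem alternating_map_opposite (b : Bool) (l : List ℕ) :
    alternating b (l.map opposite) = alternating (!b) l := by
  induction l generalizing b with
  | nil => rfl
  | cons x l ih =>
    simp only [List.map_cons, alternating, ih, bodd_opposite]
    congr 1
    cases b <;> cases x.bodd <;> rfl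

theorem insertionSort_eq_of_perm {l l' : List ℕ} (h : l.Perm l') (hl' : l'.Pairwise (· ≤ ·)) :
    l.insertionSort (· ≤ ·) = l' :=
  ((List.perm_insertionSort _ l).trans h).eq_of_pairwise
    (fun _ _ _ _ h₁ h₂ => le_antisymm h₁ h₂) (List.pairwise_insertionSort _ l) hl'

theorem insertionSort_map_opposite {l : List ℕ} (h : Compatible l) :
    (l.map opposite).insertionSort (· ≤ ·) = (l.insertionSort (· ≤ ·)).map opposite := by
  refine insertionSort_eq_of_perm ((List.perm_insertionSort _ l).symm.map _) ?_
  rw [List.pairwise_map]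
  refine (List.pairwise_insertionSort (· ≤ ·) l).imp_of_mem fun {x y} hx hy hxy => ?_
  rw [List.mem_insertionSort] at hx hy
  have h1 := opposite_div_two x
  have h2 := opposite_div_two y
  by_cases hd : x / 2 = y / 2
  · rw [h x hx y hy hd]
  · omega

theorem coboundary_alternating_insertionSort (b : Bool) (l : List ℕ) :
    coboundary (fun l' : List ℕ => alternating b (l'.insertionSort (· ≤ ·))) l =
      coboundary (alternating b) (l.insertionSort (· ≤ ·)) := by
  rw [coboundary_perm (l' := l.insertionSort (· ≤ ·)) _ (List.perm_insertionSort _ l).symm]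
  · refine coboundary_congr fun l' hl' => ?_
    rw [insertionSort_eq_of_perm (List.Perm.refl l')
      ((List.pairwise_insertionSort (· ≤ ·) l).sublist hl')]
  · intro l₁ l₂ h
    rw [insertionSort_eq_of_perm (h.trans (List.perm_insertionSort _ l₂).symm)
      (List.pairwise_insertionSort _ l₂)]

theorem length_le_of_alternating {m : ℕ} {b : Bool} {l : List ℕ} (hs : l.Pairwise (· ≤ ·))
    (hc : Compatible l) (hm : ∀ x ∈ l, x / 2 < m) (ha : alternating b l ≠ 0) :
    l.length ≤ m := by
  have hchain : l.IsChain fun x y => x / 2 < y / 2 := by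
    clear hm
    induction l generalizing b with
    | nil => exact List.IsChain.nil
    | cons x l ih =>
      have ha' : alternating (!b) l ≠ 0 := right_ne_zero_of_mul ha
      have hl := ih (List.pairwise_cons.mp hs).2
        (fun u hu v hv => hc u (List.mem_cons_of_mem _ hu) v (List.mem_cons_of_mem _ hv)) ha'
      cases l with
      | nil => exact List.IsChain.singleton x
      | cons y l =>
        refine List.IsChain.cons_cons ?_ hl
        have hx : x.bodd = b := by
          by_contra h
          simp [alternating, h] at ha
        have hy : y.bodd = !b := by
          by_contra h
          simp [alternating, h] at ha'
        have hxy : x ≤ y := (List.pairwise_cons.mp hs).1 y List.mem_cons_self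
        have hne : x / 2 ≠ y / 2 := fun h => by
          rw [hc x (by simp) y (by simp) h, hy] at hx
          cases b <;> simp at hx
        omega
  have hp : (l.map (· / 2)).Pairwise (· < ·) := by
    exact List.isChain_iff_pairwise.mp ((List.isChain_map (· / 2)).mpr hchain)
  have hnd : (l.map (· / 2)).Nodup := hp.imp fun h => h.ne
  have hsub : (l.map (· / 2)).toFinset ⊆ Finset.range m := by
    intro x hx
    simp only [List.mem_toFinset, List.mem_map] at hx
    obtain ⟨y, hy, rfl⟩ := hx
    exact Finset.mem_range.mpr (hm y hy)
  simpa [List.toFinset_card_of_nodup hnd] using Finset.card_le_card hsub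

/-- **Tucker's lemma** for the barycentric subdivision of the boundary of the cross-polytope, the
label of `X` having absolute value `μ X` and sign `s X`. -/
theorem le_of_labelling {n m : ℕ} (μ : SignVec → ℕ) (s : SignVec → Bool)
    (hμ : ∀ X, IsVertex n X → μ (-X) = μ X) (hs : ∀ X, IsVertex n X → s (-X) = !s X)
    (hm : ∀ X, IsVertex n X → μ X < m)
    (hc : ∀ X Y, IsVertex n X → IsVertex n Y → Extends X Y → μ X = μ Y → s X = s Y) :
    n ≤ m := by
  set lab : SignVec → ℕ := fun X => Nat.bit (s X) (μ X) with hlab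
  have lab_div (X) : lab X / 2 = μ X := Nat.bit_div_two _ _
  have lab_neg (X) (hX : IsVertex n X) : lab (-X) = opposite (lab X) := by
    simp only [hlab, hμ X hX, hs X hX, opposite, Nat.bodd_bit]
    cases s X <;> simp [Nat.bit]
  have compat {d : ℕ} (hd : d ≤ n) {l : List SignVec} (hl : IsFlag d l) :
      Compatible (l.map lab) := by
    have hv (X) (hX : X ∈ l) : IsVertex n X := (hl.2.2 X hX).mono hd
    have hp : l.Pairwise fun X Y => μ X = μ Y → s X = s Y :=
      hl.2.1.imp_of_mem fun hX hY h => hc _ _ (hv _ hX) (hv _ hY) h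
    intro x hx y hy hxy
    obtain ⟨X, hX, rfl⟩ := List.mem_map.mp hx
    obtain ⟨Y, hY, rfl⟩ := List.mem_map.mp hy
    rw [lab_div, lab_div] at hxy
    have hsym : s X = s Y := by
      exact hp.forall_of_forall_of_flip (fun _ _ _ => rfl)
        (hp.imp fun h h' => (h h'.symm).symm) hX hY hxy
    simp only [hlab, hxy, hsym]
  set Φ : List SignVec → ZMod 2 :=
    fun l => alternating true ((l.map lab).insertionSort (· ≤ ·)) with hΦ
  have hone (d : ℕ) (hd : d ≤ n) : sphereEval d Φ = 1 := by
    induction d with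
    | zero => rfl
    | succ d ih =>
      rw [← ih (by omega)]
      refine sphereEval_succ_of_coboundary fun l hl => ?_
      have hneg : (l.map Neg.neg).map lab = (l.map lab).map opposite := by
        simp only [List.map_map]
        exact List.map_congr_left fun X hX => lab_neg X ((hl.2.2 X hX).mono hd)
      rw [hΦ, coboundary_map lab (fun l => alternating true (l.insertionSort (· ≤ ·))) l,
        coboundary_alternating_insertionSort, coboundary_alternating]
      simp only [hneg]
      rw [insertionSort_map_opposite (compat hd hl), alternating_map_opposite]
  obtain ⟨l, hl, hne⟩ : ∃ l, IsFlag n l ∧ Φ l ≠ 0 := by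
    by_contra! h
    have h0 : sphereEval n Φ = sphereEval n (coboundary fun _ => 0) :=
      sphereEval_congr fun l hl => by
        rw [h l hl]
        simpa using (coboundary_const_mul 0 (fun _ => 0) l).symm
    rw [hone n le_rfl, sphereEval_coboundary] at h0
    exact one_ne_zero h0
  have hlen := length_le_of_alternating (m := m) (List.pairwise_insertionSort (· ≤ ·) (l.map lab))
    (fun x hx y hy => by
      rw [List.mem_insertionSort] at hx hy
      exact compat le_rfl hl x hx y hy)
    (fun x hx => by
      rw [List.mem_insertionSort] at hx
      obtain ⟨X, hX, rfl⟩ := List.mem_map.mp hx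
      rw [lab_div]
      exact hm X (hl.2.2 X hX)) hne
  simpa [hl.1] using hlen

/-- Tucker's lemma for the labelling of `X` by the largest `v` such that `Q X v` (with sign `+`)
or `Q (-X) v` (with sign `-`). -/
theorem le_of_monotone_predicate {n m : ℕ} (Q : SignVec → ℕ → Prop)
    (hmono : ∀ X Y v, Extends X Y → Q X v → Q Y v) (hm : ∀ X v, Q X v → v < m)
    (hex : ∀ X, IsVertex n X → ∃ v, Q X v ∨ Q (-X) v)
    (hstep : ∀ X v, Q X v → Q (-X) v → ∃ w, v < w ∧ (Q X w ∨ Q (-X) w)) : n ≤ m := by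
  classical
  set R : SignVec → ℕ → Prop := fun X v => Q X v ∨ Q (-X) v with hR
  have hRneg (X) : R (-X) = R X := by
    funext v
    simp only [hR, neg_neg, or_comm]
  set μ : SignVec → ℕ := fun X => Nat.findGreatest (R X) m with hμ
  have hμR (X) (hX : IsVertex n X) : R X (μ X) := by
    obtain ⟨v, hv⟩ := hex X hX
    exact Nat.findGreatest_spec (P := R X) (hv.elim (hm _ _) (hm _ _)).le hv
  have hμneg (X) : μ (-X) = μ X := by simp only [hμ, hRneg]
  have hnot (X) : ¬(Q X (μ X) ∧ Q (-X) (μ X)) := by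
    rintro ⟨h1, h2⟩
    obtain ⟨w, hw, hw'⟩ := hstep X _ h1 h2
    exact (Nat.le_findGreatest (P := R X) (hw'.elim (hm _ _) (hm _ _)).le hw').not_gt hw
  refine le_of_labelling μ (fun X => decide (Q X (μ X))) (fun X _ => hμneg X) ?_ ?_ ?_
  · intro X hX
    have h1 := hμR X hX
    have h2 := hnot X
    simp only [hR] at h1
    rw [hμneg]
    by_cases h : Q X (μ X)
    · have h3 : ¬Q (-X) (μ X) := fun h' => h2 ⟨h, h'⟩
      simp [h, h3]
    · simp [h, h1.resolve_left h]
  · intro X hX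
    exact (hμR X hX).elim (hm _ _) (hm _ _)
  · intro X Y hX hY hXY hv
    have h2 := hnot Y
    rcases hμR X hX with h | h
    · have := hmono _ _ _ hXY h
      rw [hv] at this
      simp [h, this]
    · have h3 := hmono _ _ _ hXY.neg h
      have h4 : ¬Q X (μ X) := fun h' => hnot X ⟨h', h⟩
      rw [hv] at h3
      have h5 : ¬Q Y (μ Y) := fun h' => h2 ⟨h', h3⟩
      simp [h4, h5]

end Tucker

namespace Schrijver

open Tucker

/-- `X` has an alternating subsequence of length `r` in positions below `n` that starts
with `+`. -/
def HasAlt (n : ℕ) (X : SignVec) (r : ℕ) : Prop :=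
  ∃ f : ℕ → ℕ, (∀ i < r, f i < n ∧ X (f i) = (-1) ^ i) ∧ ∀ i, i + 1 < r → f i < f (i + 1)

theorem HasAlt.mono {n r : ℕ} {X Y : SignVec} (h : HasAlt n X r) (hXY : Extends X Y) :
    HasAlt n Y r := by
  obtain ⟨f, h1, h2⟩ := h
  refine ⟨f, fun i hi => ⟨(h1 i hi).1, ?_⟩, h2⟩
  rw [hXY _ (by rw [(h1 i hi).2]; exact pow_ne_zero _ (by decide)), (h1 i hi).2]

theorem HasAlt.cons {n r a : ℕ} {X : SignVec} {g : ℕ → ℕ} (ha : a < n) (hX : X a = 1)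
    (h1 : ∀ i < r, g i < n ∧ (-X) (g i) = (-1) ^ i) (h2 : ∀ i, i + 1 < r → g i < g (i + 1))
    (hag : a < g 0) : HasAlt n X (r + 1) := by
  refine ⟨fun i => Nat.casesOn i a g, fun i hi => ?_, fun i hi => ?_⟩
  · cases i with
    | zero => exact ⟨ha, by simpa using hX⟩
    | succ i =>
      obtain ⟨h, h'⟩ := h1 i (by omega)
      refine ⟨h, ?_⟩
      rw [Pi.neg_apply] at h'
      rw [pow_succ, ← h']
      simp
  · cases i with
    | zero => exact hag
    | succ i => exact h2 i (by omega)

theorem HasAlt.succ_of_neg {n r : ℕ} (hr : 1 ≤ r) {X : SignVec} (h : HasAlt n X r)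
    (h' : HasAlt n (-X) r) : HasAlt n X (r + 1) ∨ HasAlt n (-X) (r + 1) := by
  obtain ⟨f, hf, hf'⟩ := h
  obtain ⟨g, hg, hg'⟩ := h'
  have hf0 := hf 0 hr
  have hg0 := hg 0 hr
  rw [pow_zero] at hf0 hg0
  rcases lt_trichotomy (f 0) (g 0) with hlt | heq | hlt
  · exact Or.inl (HasAlt.cons hf0.1 hf0.2 hg hg' hlt)
  · have h1 := hg0.2
    rw [← heq, Pi.neg_apply, hf0.2] at h1
    exact absurd h1 (by decide)
  · exact Or.inr (HasAlt.cons hg0.1 hg0.2 (by simpa using hf) hf' hlt)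

theorem schrijverVertex_image {n k : ℕ} {g : ℕ → ℕ} (hn : ∀ i < k, g i < n)
    (hstep : ∀ i j, i < j → j < k → g i + 2 ≤ g j ∧ g j + 2 ≤ g i + n) :
    SchrijverVertex n k ((Finset.range k).image fun i => g i + 1) := by
  refine ⟨?_, ?_, ?_⟩
  · intro a ha
    obtain ⟨i, hi, rfl⟩ := Finset.mem_image.mp ha
    have := hn i (Finset.mem_range.mp hi)
    exact Finset.mem_Icc.mpr ⟨by omega, by omega⟩
  · rw [Finset.card_image_of_injOn, Finset.card_range]
    intro i hi j hj hij
    simp only [Finset.coe_range, Set.mem_Iio] at hi hj hij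
    rcases lt_trichotomy i j with h | h | h
    · have := hstep i j h hj
      omega
    · exact h
    · have := hstep j i h hi
      omega
  · intro a ha b hb hab
    obtain ⟨i, hi, rfl⟩ := Finset.mem_image.mp ha
    obtain ⟨j, hj, rfl⟩ := Finset.mem_image.mp hb
    rw [Finset.mem_range] at hi hj
    rcases lt_trichotomy i j with h | h | h
    · have := hstep i j h hj
      omega
    · subst h; omega
    · have := hstep j i h hi
      omega

theorem HasAlt.exists_vertices {n k : ℕ} {X : SignVec} (h : HasAlt n X (2 * k)) :
    ∃ A B, SchrijverVertex n k A ∧ SchrijverVertex n k B ∧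
      (∀ a ∈ A, X (a - 1) = 1) ∧ ∀ b ∈ B, (-X) (b - 1) = 1 := by
  obtain ⟨f, h1, h2⟩ := h
  have hlt (i j : ℕ) (hij : i < j) (hj : j < 2 * k) : f i < f j := by
    induction j, hij using Nat.le_induction with
    | base => exact h2 i hj
    | succ j hij ih => exact (ih (by omega)).trans (h2 j hj)
  refine ⟨_, _, schrijverVertex_image (g := fun i => f (2 * i)) (fun i hi => (h1 _ (by omega)).1) ?_,
    schrijverVertex_image (g := fun i => f (2 * i + 1)) (fun i hi => (h1 _ (by omega)).1) ?_,
    ?_, ?_⟩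
  · intro i j hij hj
    have e1 := hlt (2 * i) (2 * i + 1) (by omega) (by omega)
    have e2 := hlt (2 * i + 1) (2 * j) (by omega) (by omega)
    have e3 := hlt (2 * j) (2 * j + 1) (by omega) (by omega)
    have e4 := (h1 (2 * j + 1) (by omega)).1
    omega
  · intro i j hij hj
    have e1 := hlt (2 * i) (2 * i + 1) (by omega) (by omega)
    have e2 := hlt (2 * i + 1) (2 * j) (by omega) (by omega)
    have e3 := hlt (2 * j) (2 * j + 1) (by omega) (by omega)
    have e4 := (h1 (2 * j + 1) (by omega)).1
    omega
  · intro a ha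
    obtain ⟨i, hi, rfl⟩ := Finset.mem_image.mp ha
    rw [Finset.mem_range] at hi
    simp [(h1 (2 * i) (by omega)).2, pow_mul]
  · intro a ha
    obtain ⟨i, hi, rfl⟩ := Finset.mem_image.mp ha
    rw [Finset.mem_range] at hi
    simp [(h1 (2 * i + 1) (by omega)).2, pow_mul, pow_succ]

theorem disjoint_of_signs {X : SignVec} {A B : Finset ℕ} (hA : ∀ a ∈ A, X (a - 1) = 1)
    (hB : ∀ b ∈ B, (-X) (b - 1) = 1) : Disjoint A B := by
  rw [Finset.disjoint_left]
  intro a ha hb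
  have h := hB a hb
  rw [Pi.neg_apply, hA a ha] at h
  exact absurd h (by decide)

end Schrijver

open Tucker Schrijver

/-- (Schrijver, lower bound) For `n ≥ 2k ≥ 2`, every proper coloring of the Schrijver
graph `KG^2([n] choose k)_{2-stab}` (adjacency = disjointness) uses at least
`n - 2k + 2` colors. -/
theorem stmt_14 (n k : ℕ) (hk : 1 ≤ k) (hn : 2 * k ≤ n) :
    ∀ t : ℕ, (∃ c : Finset ℕ → Fin t,
        ∀ A B : Finset ℕ, SchrijverVertex n k A → SchrijverVertex n k B →
          Disjoint A B → c A ≠ c B) →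
      n - 2 * k + 2 ≤ t := by
  rintro t ⟨c, hc⟩
  set Q : SignVec → ℕ → Prop := fun X v => (v + 1 < 2 * k ∧ HasAlt n X (v + 1)) ∨
    ∃ A, SchrijverVertex n k A ∧ (∀ a ∈ A, X (a - 1) = 1) ∧ 1 ≤ (c A : ℕ) ∧
      v + 2 = 2 * k + c A with hQ
  have ht : 0 < t := (c ∅).pos
  have hsplit (X : SignVec) (h : HasAlt n X (2 * k)) :
      ∃ w, 2 * k ≤ w + 1 ∧ (Q X w ∨ Q (-X) w) := by
    obtain ⟨A, B, hA, hB, hAX, hBX⟩ := h.exists_vertices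
    have hne := hc A B hA hB (disjoint_of_signs hAX hBX)
    rw [Ne, Fin.ext_iff] at hne
    by_cases h0 : 1 ≤ (c A : ℕ)
    · exact ⟨2 * k + c A - 2, by omega, Or.inl (Or.inr ⟨A, hA, hAX, h0, by omega⟩)⟩
    · exact ⟨2 * k + c B - 2, by omega, Or.inr (Or.inr ⟨B, hB, hBX, by omega, by omega⟩)⟩
  have key : n ≤ 2 * k + t - 2 := by
    refine le_of_monotone_predicate Q ?_ ?_ ?_ ?_
    · rintro X Y v hXY (⟨h, h'⟩ | ⟨A, hA, hAX, h⟩)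
      · exact Or.inl ⟨h, h'.mono hXY⟩
      · refine Or.inr ⟨A, hA, fun a ha => ?_, h⟩
        rw [hXY _ (by rw [hAX a ha]; decide), hAX a ha]
    · rintro X v (⟨h, -⟩ | ⟨A, -, -, -, h⟩)
      · omega
      · have := (c A).isLt
        omega
    · intro X hX
      obtain ⟨i, hi⟩ := Function.ne_iff.mp hX.1
      have hin : i < n := by
        by_contra h
        exact hi (hX.2 i (not_lt.mp h))
      refine ⟨0, ?_⟩
      have hcases : X i = 1 ∨ (-X) i = 1 := by
        rw [Pi.neg_apply]
        rw [Pi.zero_apply] at hi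
        revert hi
        generalize X i = s
        revert s
        decide
      refine hcases.imp ?_ ?_ <;>
      · intro h
        refine Or.inl ⟨by omega, fun _ => i, fun j hj => ?_, fun j hj => by omega⟩
        obtain rfl : j = 0 := by omega
        exact ⟨hin, by simpa using h⟩
    · rintro X v (⟨h, h'⟩ | ⟨A, hA, hAX, h, h'⟩) (⟨g, g'⟩ | ⟨B, hB, hBX, g, g'⟩)
      · by_cases hv : v + 2 < 2 * k
        · refine ⟨v + 1, by omega, ?_⟩
          exact (h'.succ_of_neg (by omega) g').imp (fun h => Or.inl ⟨hv, h⟩)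
            fun h => Or.inl ⟨hv, h⟩
        · have hvk : v + 1 + 1 = 2 * k := by omega
          rcases h'.succ_of_neg (by omega) g' with h | h
          · obtain ⟨w, hw, hw'⟩ := hsplit X (hvk ▸ h)
            exact ⟨w, by omega, hw'⟩
          · obtain ⟨w, hw, hw'⟩ := hsplit (-X) (hvk ▸ h)
            rw [neg_neg] at hw'
            exact ⟨w, by omega, hw'.symm⟩
      · omega
      · omega
      · exact absurd (Fin.ext (by omega)) (hc A B hA hB (disjoint_of_signs hAX hBX))
  omega
end

section
/- (Schrijver upper bound) For n ≥ 2k, the Schrijver graph KG^2([n] choose k)_{2-stab} admits a proper coloring with n - 2k + 2 colors, hence its chromatic number equals n - 2k + 2. -/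
namespace Schrijver

section OctahedralTucker

open Finset
open scoped Pointwise

/-- A finite set of nonzero integers of absolute value at most `d`, containing no two opposite
elements, encodes a sign vector of length `d`. -/
def Signed (d : ℕ) (x : Finset ℤ) : Prop :=
  ∀ v ∈ x, -v ∉ x ∧ -(d : ℤ) ≤ v ∧ v ≤ d

lemma Signed.mono {d : ℕ} {x y : Finset ℤ} (hy : Signed d y) (h : x ⊆ y) : Signed d x :=
  fun v hv => ⟨fun h' => (hy v (h hv)).1 (h h'), (hy v (h hv)).2⟩

lemma Signed.neg {d : ℕ} {x : Finset ℤ} (hx : Signed d x) : Signed d (-x) := by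
  intro v hv
  rw [mem_neg'] at hv
  have := hx _ hv
  rw [mem_neg']
  exact ⟨this.1, by omega, by omega⟩

lemma Signed.le {d e : ℕ} {x : Finset ℤ} (hx : Signed d x) (h : d ≤ e) : Signed e x := by
  intro v hv
  have := hx _ hv
  exact ⟨this.1, by omega, by omega⟩

/-- Indicator of the finite sets whose elements, sorted by decreasing absolute value, alternate in
sign and start with a positive one; only elements of absolute value at most `j` are considered. -/
def altIndicator : ℕ → Finset ℤ → ZMod 2
  | 0, _ => 1
  | j + 1, S =>
    if (j : ℤ) + 1 ∈ S then altIndicator j (-S)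
    else if -((j : ℤ) + 1) ∈ S then 0 else altIndicator j S

lemma altIndicator_congr (j : ℕ) : ∀ S T : Finset ℤ,
    (∀ v : ℤ, -(j : ℤ) ≤ v → v ≤ j → (v ∈ S ↔ v ∈ T)) → altIndicator j S = altIndicator j T := by
  induction j with
  | zero => intro S T _; rfl
  | succ j ih =>
    intro S T h
    push_cast at h
    have h1 := h (j + 1) (by omega) (by omega)
    have h2 := h (-((j : ℤ) + 1)) (by omega) (by omega)
    have h3 := ih S T fun v _ _ => h v (by omega) (by omega)
    have h4 := ih (-S) (-T) fun v _ _ => by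
      rw [mem_neg', mem_neg']; exact h _ (by omega) (by omega)
    simp only [altIndicator, h1, h2, h3, h4]

/-- Ky Fan's parity observation. -/
lemma sum_altIndicator_erase (j : ℕ) : ∀ S : Finset ℤ, Signed j S →
    ∑ v ∈ S, altIndicator j (S.erase v) = altIndicator j S + altIndicator j (-S) := by
  induction j with
  | zero =>
    intro S hS
    have : S = ∅ := by
      refine eq_empty_of_forall_notMem fun v hv => ?_
      have h := hS v hv
      have : v = 0 := by push_cast at h; omega
      subst this
      exact h.1 (by simpa using hv)
    subst this
    simp only [sum_empty, altIndicator]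
    decide
  | succ j ih =>
    intro S hS
    have hout : ∀ v ∈ S, v ≠ (j : ℤ) + 1 → v ≠ -((j : ℤ) + 1) → -(j : ℤ) ≤ v ∧ v ≤ j := by
      intro v hv h1 h2
      have := (hS v hv).2
      push_cast at this
      omega
    by_cases hw : (j : ℤ) + 1 ∈ S
    · have hw' : -((j : ℤ) + 1) ∉ S := (hS _ hw).1
      set R := S.erase ((j : ℤ) + 1) with hR
      have hRs : Signed j R := fun v hv => by
        have hvS := mem_of_mem_erase hv
        exact ⟨fun h => (hS v hvS).1 (mem_of_mem_erase h),
          hout v hvS (ne_of_mem_erase hv) (fun h => hw' (h ▸ hvS))⟩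
      rw [← add_sum_erase _ _ hw]
      have e1 : altIndicator (j + 1) R = altIndicator j R := by
        rw [altIndicator, if_neg (notMem_erase _ _), if_neg fun h => hw' (mem_of_mem_erase h)]
      have e2 : ∑ v ∈ R, altIndicator (j + 1) (S.erase v)
          = ∑ u ∈ -R, altIndicator j ((-R).erase u) := by
        refine sum_bij' (fun v _ => -v) (fun u _ => -u) ?_ ?_ ?_ ?_ ?_
        · intro v hv; simpa [mem_neg'] using hv
        · intro v hv; simpa [mem_neg'] using hv
        · simp
        · simp
        · intro v hv
          have hmem : (j : ℤ) + 1 ∈ S.erase v := mem_erase.2 ⟨(ne_of_mem_erase hv).symm, hw⟩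
          rw [altIndicator, if_pos hmem]
          apply altIndicator_congr
          intro u hu1 hu2
          simp only [mem_neg', mem_erase, hR]
          constructor
          · rintro ⟨a, b⟩; exact ⟨by omega, by omega, b⟩
          · rintro ⟨a, _, b⟩; exact ⟨by omega, b⟩
      have e3 : altIndicator (j + 1) S = altIndicator j (-R) := by
        rw [altIndicator, if_pos hw]
        apply altIndicator_congr
        intro u hu1 hu2
        simp only [mem_neg', mem_erase, hR]
        exact ⟨fun b => ⟨by omega, b⟩, fun b => b.2⟩
      have e4 : altIndicator (j + 1) (-S) = 0 := by
        rw [altIndicator, if_neg (by rwa [mem_neg']), if_pos (by rwa [mem_neg', neg_neg])]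
      rw [e1, e2, e3, e4, ih _ hRs.neg, neg_neg, add_comm (altIndicator j (-R)), ← add_assoc,
        CharTwo.add_self_eq_zero, zero_add, add_zero]
    · by_cases hw' : -((j : ℤ) + 1) ∈ S
      · rw [← add_sum_erase _ _ hw', sum_eq_zero, add_zero]
        · simp only [altIndicator, mem_neg', hw, hw', mem_erase, if_true, if_false, neg_neg,
            ne_eq, not_true, false_and, and_false, zero_add]
          apply altIndicator_congr
          intro u hu1 hu2
          simp only [mem_erase]
          exact ⟨fun b => b.2, fun b => ⟨by omega, b⟩⟩
        · intro v hv
          have h1 := ne_of_mem_erase hv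
          rw [altIndicator, if_neg (fun h => hw (mem_of_mem_erase h)),
            if_pos (mem_erase.2 ⟨h1.symm, hw'⟩)]
      · have hSj : Signed j S := fun v hv =>
          ⟨(hS v hv).1, hout v hv (fun h => hw (h ▸ hv)) (fun h => hw' (h ▸ hv))⟩
        have := ih S hSj
        simpa only [altIndicator, mem_erase, mem_neg', neg_neg, hw, hw', and_false, if_false]
          using this

/-- The number modulo `2` of maximal flags of nonempty subsets of `x` whose labels under `l` are
pairwise distinct and form the set `S`. -/
def flagCount (l : Finset ℤ → ℤ) (x S : Finset ℤ) : ZMod 2 :=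
  if x = ∅ then (if S = ∅ then 1 else 0)
  else if l x ∈ S then ∑ p ∈ x.attach, flagCount l (x.erase p) (S.erase (l x)) else 0
termination_by x.card
decreasing_by exact card_erase_lt_of_mem p.2

lemma flagCount_empty (l : Finset ℤ → ℤ) (S : Finset ℤ) :
    flagCount l ∅ S = if S = ∅ then 1 else 0 := by
  rw [flagCount, if_pos rfl]

lemma flagCount_of_nonempty (l : Finset ℤ → ℤ) {x : Finset ℤ} (hx : x.Nonempty) (S : Finset ℤ) :
    flagCount l x S =
      if l x ∈ S then ∑ p ∈ x, flagCount l (x.erase p) (S.erase (l x)) else 0 := by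
  rw [flagCount, if_neg hx.ne_empty, sum_attach x fun p => flagCount l (x.erase p) (S.erase (l x))]

lemma sum_sum_erase_erase (f : Finset ℤ → ZMod 2) (x : Finset ℤ) :
    ∑ p ∈ x, ∑ q ∈ x.erase p, f ((x.erase p).erase q) = 0 := by
  rw [sum_sigma']
  refine sum_involution (fun a _ => ⟨a.2, a.1⟩) ?_ ?_ ?_ ?_
  · rintro ⟨p, q⟩ _
    simp only
    rw [erase_right_comm, CharTwo.add_self_eq_zero]
  · rintro ⟨p, q⟩ h _ h'
    simp only [mem_sigma, mem_erase] at h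
    simp only [Sigma.mk.injEq] at h'
    exact h.2.1 h'.1
  · rintro ⟨p, q⟩ h
    simp only [mem_sigma, mem_erase] at h ⊢
    exact ⟨h.2.2, h.2.1.symm, h.1⟩
  · rintro ⟨p, q⟩ _; rfl

/-- The boundary of the chain of all maximal flags of `x`. -/
lemma sum_flagCount_insert (l : Finset ℤ → ℤ) (U : Finset ℤ) (r : ℕ) :
    ∀ x : Finset ℤ, x.card = r → (∀ y ⊆ x, y.Nonempty → l y ∈ U) → ∀ T : Finset ℤ,
      ∑ v ∈ U \ T, flagCount l x (insert v T) = ∑ p ∈ x, flagCount l (x.erase p) T := by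
  induction r with
  | zero =>
    intro x hx _ T
    rw [card_eq_zero.1 hx]
    simp [flagCount_empty]
  | succ r ih =>
    intro x hx hU T
    have hne : x.Nonempty := card_pos.1 (by omega)
    have hcyc : ∀ R : Finset ℤ, ∑ v ∈ U \ R, ∑ p ∈ x, flagCount l (x.erase p) (insert v R) = 0 := by
      intro R
      rw [sum_comm, ← sum_sum_erase_erase (fun y => flagCount l y R) x]
      refine sum_congr rfl fun p hp => ?_
      refine ih _ (by rw [card_erase_of_mem hp]; omega) ?_ R
      exact fun y hy => hU y (hy.trans (erase_subset _ _))
    simp only [flagCount_of_nonempty l hne]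
    have hlU := hU x subset_rfl hne
    by_cases hl : l x ∈ T
    · have key := hcyc (T.erase (l x))
      have hset : U \ T.erase (l x) = insert (l x) (U \ T) := by
        ext u
        simp only [mem_sdiff, mem_erase, mem_insert]
        by_cases hu : u = l x
        · simp [hu, hlU]
        · simp [hu]
      rw [hset, sum_insert (by simp [hl]), insert_erase hl] at key
      rw [← sub_eq_zero, CharTwo.sub_eq_add, add_comm, ← key]
      congr 1
      refine sum_congr rfl fun v hv => ?_
      rw [if_pos (mem_insert_of_mem hl), erase_insert_of_ne]
      rintro rfl
      exact (mem_sdiff.1 hv).2 hl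
    · rw [sum_eq_single (l x)]
      · rw [if_pos (mem_insert_self _ _), erase_insert hl]
      · intro v _ hv
        rw [if_neg]
        simp [hv.symm, hl]
      · intro h
        exact absurd (mem_sdiff.2 ⟨hlU, hl⟩) h

lemma flagCount_neg (l : Finset ℤ → ℤ) (r : ℕ) :
    ∀ x : Finset ℤ, x.card = r → (∀ y ⊆ x, y.Nonempty → l (-y) = -l y) → ∀ S : Finset ℤ,
      flagCount l (-x) (-S) = flagCount l x S := by
  have hneg : ∀ (x : Finset ℤ) (p : ℤ), (-x).erase (-p) = -x.erase p := by
    intro x p; ext u; simp only [mem_erase, mem_neg']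
    exact and_congr_left fun _ => not_congr ⟨fun h => by omega, fun h => by omega⟩
  induction r with
  | zero =>
    intro x hx _ S
    rw [card_eq_zero.1 hx]
    simp [flagCount_empty]
  | succ r ih =>
    intro x hx hl S
    have hne : x.Nonempty := card_pos.1 (by omega)
    rw [flagCount_of_nonempty l hne, flagCount_of_nonempty l hne.neg, hl x subset_rfl hne]
    simp only [mem_neg', neg_neg]
    congr 1
    refine (sum_bij' (fun v _ => -v) (fun u _ => -u) ?_ ?_ ?_ ?_ ?_).symm
    · intro v hv; simpa [mem_neg'] using hv
    · intro v hv; simpa [mem_neg'] using hv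
    · simp
    · simp
    · intro p hp
      rw [hneg, hneg, ih _ (by rw [card_erase_of_mem hp]; omega)]
      exact fun y hy => hl y (hy.trans (erase_subset _ _))

lemma flagCount_support (l : Finset ℤ → ℤ) (r : ℕ) :
    ∀ x : Finset ℤ, x.card = r →
      (∀ y z : Finset ℤ, y ⊆ z → z ⊆ x → y.Nonempty → l y ≠ -l z) → ∀ S : Finset ℤ,
      flagCount l x S ≠ 0 →
        S.card = r ∧ (∀ v ∈ S, ∃ y ⊆ x, y.Nonempty ∧ l y = v) ∧ ∀ v ∈ S, -v ∉ S := by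
  induction r with
  | zero =>
    intro x hx _ S hS
    rw [card_eq_zero.1 hx, flagCount_empty] at hS
    have : S = ∅ := by by_contra h; simp [h] at hS
    subst this
    simp
  | succ r ih =>
    intro x hx hl S hS
    have hne : x.Nonempty := card_pos.1 (by omega)
    rw [flagCount_of_nonempty l hne] at hS
    have hmem : l x ∈ S := by by_contra h; simp [h] at hS
    rw [if_pos hmem] at hS
    obtain ⟨p, hp, hpS⟩ := exists_ne_zero_of_sum_ne_zero hS
    obtain ⟨h1, h2, h3⟩ := ih _ (by rw [card_erase_of_mem hp]; omega)
      (fun y z hyz hz => hl y z hyz (hz.trans (erase_subset _ _))) _ hpS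
    rw [card_erase_of_mem hmem] at h1
    have hpos : 0 < S.card := card_pos.2 ⟨_, hmem⟩
    have h2' : ∀ v ∈ S, ∃ y ⊆ x, y.Nonempty ∧ l y = v := by
      intro v hv
      by_cases hvx : v = l x
      · exact ⟨x, subset_rfl, hne, hvx.symm⟩
      · obtain ⟨y, hy, hy'⟩ := h2 v (mem_erase.2 ⟨hvx, hv⟩)
        exact ⟨y, hy.trans (erase_subset _ _), hy'⟩
    refine ⟨by omega, h2', fun v hv hv' => ?_⟩
    by_cases hvx : v = l x
    · obtain ⟨y, hy, hyne, hly⟩ := h2' _ hv'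
      exact hl y x hy subset_rfl hyne (by rw [hly, hvx])
    · by_cases hvx' : -v = l x
      · obtain ⟨y, hy, hyne, hly⟩ := h2' _ hv
        exact hl y x hy subset_rfl hyne (by rw [hly, ← hvx', neg_neg])
      · exact h3 v (mem_erase.2 ⟨hvx, hv⟩) (mem_erase.2 ⟨hvx', hv'⟩)

/-- The sum of `f` over the sign vectors of length `d` without zero entries. -/
def signSum : ℕ → (Finset ℤ → ZMod 2) → ZMod 2
  | 0, f => f ∅
  | d + 1, f => signSum d fun z => f (insert ((d : ℤ) + 1) z) + f (insert (-((d : ℤ) + 1)) z)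

lemma Signed.insert_top {d : ℕ} {z : Finset ℤ} (hz : Signed d z) {w : ℤ}
    (hw : w = d + 1 ∨ w = -((d : ℤ) + 1)) : w ∉ z ∧ Signed (d + 1) (insert w z) := by
  have h0 : w ∉ z ∧ -w ∉ z := by
    constructor <;> intro h <;> have := (hz _ h).2 <;> omega
  refine ⟨h0.1, fun v hv => ?_⟩
  push_cast
  rcases mem_insert.1 hv with rfl | hv
  · refine ⟨?_, by omega, by omega⟩
    rw [mem_insert, not_or]
    exact ⟨by omega, h0.2⟩
  · have h := hz v hv
    refine ⟨?_, by omega, by omega⟩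
    rw [mem_insert, not_or]
    exact ⟨by omega, h.1⟩

lemma signSum_congr (d : ℕ) : ∀ f g : Finset ℤ → ZMod 2,
    (∀ z, Signed d z → z.card = d → f z = g z) → signSum d f = signSum d g := by
  induction d with
  | zero => intro f g h; exact h ∅ (by simp [Signed]) rfl
  | succ d ih =>
    intro f g h
    refine ih _ _ fun z hz hc => ?_
    have h1 := hz.insert_top (Or.inl rfl)
    have h2 := hz.insert_top (Or.inr rfl)
    rw [h _ h1.2 (by rw [card_insert_of_notMem h1.1, hc]),
      h _ h2.2 (by rw [card_insert_of_notMem h2.1, hc])]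

lemma signSum_zero (d : ℕ) : signSum d (fun _ => 0) = 0 := by
  induction d with
  | zero => rfl
  | succ d ih => simpa [signSum] using ih

lemma signSum_add (d : ℕ) : ∀ f g : Finset ℤ → ZMod 2,
    signSum d (fun z => f z + g z) = signSum d f + signSum d g := by
  induction d with
  | zero => intro f g; rfl
  | succ d ih =>
    intro f g
    simp only [signSum]
    rw [← ih]
    congr 1
    funext z
    ring

lemma neg_insert_eq (a : ℤ) (x : Finset ℤ) : -(insert a x) = insert (-a) (-x) := by
  ext u
  simp only [mem_neg', mem_insert]
  exact or_congr_left ⟨fun h => by omega, fun h => by omega⟩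

lemma signSum_neg (d : ℕ) : ∀ f : Finset ℤ → ZMod 2,
    signSum d (fun z => f (-z)) = signSum d f := by
  induction d with
  | zero => intro f; simp [signSum]
  | succ d ih =>
    intro f
    simp only [signSum]
    rw [← ih fun z => f (insert ((d : ℤ) + 1) z) + f (insert (-((d : ℤ) + 1)) z)]
    congr 1
    funext z
    rw [neg_insert_eq, neg_insert_eq, neg_neg, add_comm]

lemma signSum_sum_erase (d : ℕ) : ∀ f : Finset ℤ → ZMod 2,
    signSum d (fun z => ∑ p ∈ z, f (z.erase p)) = 0 := by
  induction d with
  | zero => intro f; simp [signSum]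
  | succ d ih =>
    intro f
    have key : ∀ w : ℤ, (w = d + 1 ∨ w = -((d : ℤ) + 1)) → ∀ z, Signed d z →
        ∑ p ∈ insert w z, f ((insert w z).erase p)
          = f z + ∑ p ∈ z, f (insert w (z.erase p)) := by
      intro w hw z hz
      have h := (hz.insert_top hw).1
      rw [sum_insert h, erase_insert h]
      congr 1
      refine sum_congr rfl fun p hp => ?_
      rw [erase_insert_of_ne]
      rintro rfl
      exact h hp
    rw [signSum, signSum_congr d _ (fun z => ∑ p ∈ z, f (insert ((d : ℤ) + 1) (z.erase p))
      + ∑ p ∈ z, f (insert (-((d : ℤ) + 1)) (z.erase p))), signSum_add,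
      ih fun z => f (insert ((d : ℤ) + 1) z), ih fun z => f (insert (-((d : ℤ) + 1)) z), add_zero]
    intro z hz _
    rw [key _ (Or.inl rfl) z hz, key _ (Or.inr rfl) z hz, add_add_add_comm,
      CharTwo.add_self_eq_zero, zero_add]

/-- The number modulo `2` of maximal flags of `x` with an alternating set of labels. -/
noncomputable def altFlagCount (l : Finset ℤ → ℤ) (m : ℕ) (x : Finset ℤ) : ZMod 2 :=
  ∑ S ∈ (Icc (-(m : ℤ)) m).powerset, flagCount l x S * altIndicator m S

lemma altFlagCount_add_neg (l : Finset ℤ → ℤ) (m : ℕ) (x : Finset ℤ)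
    (hU : ∀ y ⊆ x, y.Nonempty → l y ∈ Icc (-(m : ℤ)) m)
    (hneg : ∀ y ⊆ x, y.Nonempty → l (-y) = -l y)
    (hcomp : ∀ y z : Finset ℤ, y ⊆ z → z ⊆ x → y.Nonempty → l y ≠ -l z) :
    altFlagCount l m x + altFlagCount l m (-x) = ∑ p ∈ x, altFlagCount l m (x.erase p) := by
  set U := Icc (-(m : ℤ)) m with hUdef
  have e1 : altFlagCount l m (-x) = ∑ S ∈ U.powerset, flagCount l x S * altIndicator m (-S) := by
    refine sum_bij' (fun v _ => -v) (fun u _ => -u) ?_ ?_ ?_ ?_ ?_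
    · intro S hS
      rw [mem_powerset] at hS ⊢
      intro v hv
      have := hS (mem_neg'.1 hv)
      simp only [mem_Icc, hUdef] at this ⊢
      omega
    · intro S hS
      rw [mem_powerset] at hS ⊢
      intro v hv
      have := hS (mem_neg'.1 hv)
      simp only [mem_Icc, hUdef] at this ⊢
      omega
    · simp
    · simp
    · intro S _
      rw [neg_neg, ← flagCount_neg l _ x rfl hneg (-S), neg_neg]
  have e2 : altFlagCount l m x + altFlagCount l m (-x)
      = ∑ S ∈ U.powerset, ∑ v ∈ S, flagCount l x S * altIndicator m (S.erase v) := by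
    rw [e1, altFlagCount, ← sum_add_distrib]
    refine sum_congr rfl fun S hS => ?_
    rw [← mul_sum, ← mul_add]
    by_cases h0 : flagCount l x S = 0
    · rw [h0, zero_mul, zero_mul]
    · rw [sum_altIndicator_erase]
      obtain ⟨-, -, h⟩ := flagCount_support l _ x rfl hcomp S h0
      intro v hv
      have := mem_powerset.1 hS hv
      rw [hUdef, mem_Icc] at this
      exact ⟨h v hv, this⟩
  rw [e2]
  simp only [altFlagCount]
  rw [sum_comm (s := x)]
  simp only [← sum_mul]
  rw [← hUdef]
  simp only [← sum_flagCount_insert l U _ x rfl hU, sum_mul]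
  rw [sum_sigma', sum_sigma']
  refine sum_bij' (fun a _ => ⟨a.1.erase a.2, a.2⟩) (fun a _ => ⟨insert a.2 a.1, a.2⟩)
    ?_ ?_ ?_ ?_ ?_
  · rintro ⟨S, v⟩ h
    simp only [mem_sigma, mem_powerset, mem_sdiff] at h ⊢
    exact ⟨(erase_subset _ _).trans h.1, h.1 h.2, notMem_erase _ _⟩
  · rintro ⟨S, v⟩ h
    simp only [mem_sigma, mem_powerset, mem_sdiff] at h ⊢
    exact ⟨insert_subset h.2.1 h.1, mem_insert_self _ _⟩
  · rintro ⟨S, v⟩ h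
    simp only [mem_sigma] at h
    simp only [insert_erase h.2]
  · rintro ⟨S, v⟩ h
    simp only [mem_sigma, mem_sdiff] at h
    simp only [erase_insert h.2.2]
  · rintro ⟨S, v⟩ h
    simp only [mem_sigma] at h
    simp only [insert_erase h.2]

lemma signSum_altFlagCount (l : Finset ℤ → ℤ) (m n : ℕ)
    (hU : ∀ y, Signed n y → y.Nonempty → l y ∈ Icc (-(m : ℤ)) m)
    (hneg : ∀ y, Signed n y → y.Nonempty → l (-y) = -l y)
    (hcomp : ∀ y z : Finset ℤ, y ⊆ z → Signed n z → y.Nonempty → l y ≠ -l z)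
    (d : ℕ) (hd : d ≤ n) : signSum d (altFlagCount l m) = 1 := by
  induction d with
  | zero =>
    have h0 : ∀ j, altIndicator j ∅ = 1 := by
      intro j
      induction j with
      | zero => rfl
      | succ j ih => simpa [altIndicator] using ih
    rw [signSum, altFlagCount, sum_eq_single ∅]
    · simp [flagCount_empty, h0]
    · intro S _ hS
      simp [flagCount_empty, hS]
    · intro h
      exact absurd (empty_mem_powerset _) h
  | succ d ih =>
    rw [signSum, signSum_add, ← signSum_neg d fun z => altFlagCount l m (insert (-((d : ℤ) + 1)) z),
      ← signSum_add, signSum_congr d _ (fun z => altFlagCount l m z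
        + ∑ p ∈ z, altFlagCount l m (insert ((d : ℤ) + 1) (z.erase p))), signSum_add,
      signSum_sum_erase d fun z => altFlagCount l m (insert ((d : ℤ) + 1) z), ih (by omega), add_zero]
    intro z hz _
    obtain ⟨h1, h2⟩ := hz.insert_top (w := (d : ℤ) + 1) (Or.inl rfl)
    have h3 := h2.le hd
    rw [← neg_insert_eq, altFlagCount_add_neg l m _ (fun y hy => hU y (h3.mono hy))
      (fun y hy => hneg y (h3.mono hy)) (fun y w hyw hw => hcomp y w hyw (h3.mono hw)),
      sum_insert h1, erase_insert h1]
    congr 1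
    refine sum_congr rfl fun p hp => ?_
    rw [erase_insert_of_ne]
    rintro rfl
    exact h1 hp

/-- The octahedral Tucker lemma. -/
theorem octahedral_tucker (l : Finset ℤ → ℤ) (m n : ℕ) (hmn : m < n)
    (hU : ∀ y, Signed n y → y.Nonempty → l y ∈ Icc (-(m : ℤ)) m)
    (hneg : ∀ y, Signed n y → y.Nonempty → l (-y) = -l y) :
    ∃ y z : Finset ℤ, y ⊆ z ∧ Signed n z ∧ y.Nonempty ∧ l y = -l z := by
  by_contra! hcomp
  have h1 := signSum_altFlagCount l m n hU hneg hcomp n le_rfl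
  rw [signSum_congr n _ fun _ => 0, signSum_zero] at h1
  · exact zero_ne_one h1
  · intro z hz hc
    refine sum_eq_zero fun S hS => ?_
    by_contra h
    obtain ⟨hS1, -, hS3⟩ := flagCount_support l _ z rfl
      (fun y w hyw hw => hcomp y w hyw (hz.mono hw)) S (left_ne_zero_of_mul h)
    have hle : S.card ≤ (Icc 1 m).card := by
      refine card_le_card_of_injOn Int.natAbs ?_ ?_
      · intro v hv
        have := mem_powerset.1 hS hv
        rw [mem_Icc] at this
        have hv0 : v ≠ 0 := by
          rintro rfl
          exact hS3 0 hv (by simpa using hv)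
        simp only [coe_Icc, Set.mem_Icc]
        omega
      · intro v hv w hw hvw
        rcases Int.natAbs_eq_natAbs_iff.1 hvw with h | h
        · exact h
        · exact absurd (by simpa [h] using hv) (hS3 w hw)
    rw [Nat.card_Icc] at hle
    omega

/-- A monotone form of the octahedral Tucker lemma. -/
theorem exists_eq_neg_of_monotone (a : Finset ℤ → ℕ) (m n : ℕ) (hmn : m < n)
    (hmono : ∀ y z : Finset ℤ, y ⊆ z → Signed n z → y.Nonempty → a y ≤ a z)
    (hle : ∀ y, Signed n y → y.Nonempty → a y ≤ m) :
    ∃ y, Signed n y ∧ y.Nonempty ∧ a y = a (-y) := by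
  by_contra! hne
  obtain ⟨y, z, hyz, hz, hy, h⟩ := octahedral_tucker
    (fun y => if a (-y) < a y then (a y : ℤ) else -(a (-y) : ℤ)) m n hmn
    (fun y hy hy' => by
      have h1 := hle y hy hy'
      have h2 := hle (-y) hy.neg hy'.neg
      rw [mem_Icc]
      split_ifs <;> omega)
    (fun y hy hy' => by
      have := hne y hy hy'
      rw [neg_neg]
      split_ifs <;> omega)
  have h1 := hmono y z hyz hz hy
  have h2 := hmono (-y) (-z) (neg_subset_neg hyz) hz.neg hy.neg
  have h3 := hne y (hz.mono hyz) hy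
  have h4 := hne z hz (hy.mono hyz)
  split_ifs at h <;> omega

end OctahedralTucker

section Alternation

open Finset
open scoped Pointwise

/-- The maximal length of a sequence of elements of `x` of absolute value at most `j`, decreasing
in absolute value and alternating in sign, that starts with a positive element. -/
def altLength : ℕ → Finset ℤ → ℕ
  | 0, _ => 0
  | j + 1, x => if (j : ℤ) + 1 ∈ x then 1 + altLength j (-x) else altLength j x

lemma altLength_le_succ_neg (j : ℕ) : ∀ x : Finset ℤ, altLength j x ≤ 1 + altLength j (-x) := by
  induction j with
  | zero => intro x; simp [altLength]
  | succ j ih =>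
    intro x
    have h1 := ih x
    have h2 := ih (-x)
    simp only [altLength, neg_neg] at h2 ⊢
    split_ifs <;> omega

lemma altLength_mono (j : ℕ) : ∀ x y : Finset ℤ, x ⊆ y → altLength j x ≤ altLength j y := by
  induction j with
  | zero => intro x y _; simp [altLength]
  | succ j ih =>
    intro x y h
    have h1 := ih x y h
    have h2 := ih (-x) (-y) (neg_subset_neg h)
    have h3 := altLength_le_succ_neg j y
    simp only [altLength]
    by_cases hx : (j : ℤ) + 1 ∈ x
    · rw [if_pos hx, if_pos (h hx)]; omega
    · rw [if_neg hx]; split_ifs <;> omega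

lemma altLength_ne_neg (j : ℕ) : ∀ x : Finset ℤ, Signed j x → x.Nonempty →
    altLength j x ≠ altLength j (-x) := by
  induction j with
  | zero =>
    rintro x hx ⟨v, hv⟩
    have h := hx v hv
    have : v = 0 := by push_cast at h; omega
    subst this
    exact absurd (by simpa using hv) h.1
  | succ j ih =>
    intro x hx hne
    simp only [altLength, mem_neg', neg_neg]
    by_cases h1 : (j : ℤ) + 1 ∈ x
    · rw [if_pos h1, if_neg (hx _ h1).1]; omega
    · rw [if_neg h1]
      by_cases h2 : -((j : ℤ) + 1) ∈ x
      · rw [if_pos h2]; omega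
      · rw [if_neg h2]
        refine ih x (fun v hv => ⟨(hx v hv).1, ?_⟩) hne
        have h3 := (hx v hv).2
        have h4 : v ≠ (j : ℤ) + 1 := fun h => h1 (h ▸ hv)
        have h5 : v ≠ -((j : ℤ) + 1) := fun h => h2 (h ▸ hv)
        push_cast at h3
        omega

lemma exists_interlacing (j : ℕ) : ∀ (r : ℕ) (x : Finset ℤ), r ≤ altLength j x →
    ∃ A B : Finset ℕ, A ⊆ Icc 1 j ∧ B ⊆ Icc 1 j ∧
      (∀ a ∈ A, (a : ℤ) ∈ x) ∧ (∀ b ∈ B, -(b : ℤ) ∈ x) ∧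
      A.card = (r + 1) / 2 ∧ B.card = r / 2 ∧
      (∀ i ∈ A, ∀ i' ∈ A, i < i' → i + 2 ≤ i') ∧ (∀ i ∈ B, ∀ i' ∈ B, i < i' → i + 2 ≤ i') ∧
      (∀ b ∈ B, ∃ a ∈ A, b < a) ∧ (1 ∈ A → r % 2 = 1) ∧ (1 ∈ B → r % 2 = 0) := by
  induction j with
  | zero =>
    intro r x hr
    have : r = 0 := by simpa [altLength] using hr
    subst this
    exact ⟨∅, ∅, by simp⟩
  | succ j ih =>
    intro r x hr
    rw [altLength] at hr
    split_ifs at hr with hx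
    · rcases Nat.eq_zero_or_pos r with rfl | hr0
      · exact ⟨∅, ∅, by simp⟩
      obtain ⟨A, B, hA, hB, hAx, hBx, hAc, hBc, hAs, hBs, hBA, hA1, hB1⟩ :=
        ih (r - 1) (-x) (by omega)
      have hBj : ∀ b ∈ B, b < j := by
        intro b hb
        obtain ⟨a, ha, hba⟩ := hBA b hb
        have := (mem_Icc.1 (hA ha)).2
        omega
      have hjB : j + 1 ∉ B := fun h => by have := hBj _ h; omega
      refine ⟨insert (j + 1) B, A, ?_, ?_, ?_, ?_, ?_, ?_, ?_, hAs, ?_, ?_, ?_⟩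
      · refine insert_subset (by simp) (hB.trans (Icc_subset_Icc_right (by omega)))
      · exact hA.trans (Icc_subset_Icc_right (by omega))
      · intro a ha
        rcases mem_insert.1 ha with rfl | ha
        · push_cast; exact hx
        · have := mem_neg'.1 (hBx a ha)
          rwa [neg_neg] at this
      · intro b hb
        exact mem_neg'.1 (hAx b hb)
      · rw [card_insert_of_notMem hjB]; omega
      · omega
      · intro i hi i' hi' hlt
        rcases mem_insert.1 hi with rfl | hi <;> rcases mem_insert.1 hi' with rfl | hi'
        · omega
        · have := hBj _ hi'; omega
        · have := hBj _ hi; omega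
        · exact hBs i hi i' hi' hlt
      · intro b hb
        have := (mem_Icc.1 (hA hb)).2
        exact ⟨j + 1, mem_insert_self _ _, by omega⟩
      · intro h
        rcases mem_insert.1 h with h | h
        · have hj : j = 0 := by omega
          subst hj
          simp only [altLength] at hr
          omega
        · have := hB1 h; omega
      · intro h
        have := hA1 h; omega
    · obtain ⟨A, B, hA, hB, h⟩ := ih r x hr
      exact ⟨A, B, hA.trans (Icc_subset_Icc_right (by omega)),
        hB.trans (Icc_subset_Icc_right (by omega)), h⟩

lemma exists_schrijverVertex {n k : ℕ} {x : Finset ℤ} (h : 2 * k ≤ altLength n x) :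
    (∃ A, SchrijverVertex n k A ∧ ∀ a ∈ A, (a : ℤ) ∈ x) ∧
      ∃ B, SchrijverVertex n k B ∧ ∀ b ∈ B, -(b : ℤ) ∈ x := by
  obtain ⟨A, B, hA, hB, hAx, hBx, hAc, hBc, hAs, hBs, hBA, hA1, -⟩ := exists_interlacing n _ x h
  refine ⟨⟨A, ⟨hA, by omega, fun i hi j hj hij => ⟨hAs i hi j hj hij, ?_⟩⟩, hAx⟩,
    ⟨B, ⟨hB, by omega, fun i hi j hj hij => ⟨hBs i hi j hj hij, ?_⟩⟩, hBx⟩⟩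
  · have h1 := mem_Icc.1 (hA hi)
    have h2 := mem_Icc.1 (hA hj)
    have h3 : i ≠ 1 := by
      rintro rfl
      have := hA1 hi
      omega
    omega
  · obtain ⟨a, ha, hja⟩ := hBA j hj
    have h1 := mem_Icc.1 (hB hi)
    have h2 := mem_Icc.1 (hA ha)
    omega

end Alternation

section Coloring

open Finset
open scoped Pointwise

open Classical in
/-- The largest color of a vertex of the Schrijver graph contained in the positive part of `x`. -/
noncomputable def maxColor (n k : ℕ) {t : ℕ} (c : Finset ℕ → Fin t) (x : Finset ℤ) : ℕ :=
  ((Icc 1 n).powerset.filter fun A => SchrijverVertex n k A ∧ ∀ a ∈ A, (a : ℤ) ∈ x).sup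
    fun A => (c A : ℕ)

lemma maxColor_mono (n k : ℕ) {t : ℕ} (c : Finset ℕ → Fin t) {x y : Finset ℤ} (h : x ⊆ y) :
    maxColor n k c x ≤ maxColor n k c y := by
  classical
  refine sup_mono fun A hA => ?_
  rw [mem_filter] at hA ⊢
  exact ⟨hA.1, hA.2.1, fun a ha => h (hA.2.2 a ha)⟩

lemma maxColor_lt (n k : ℕ) {t : ℕ} (c : Finset ℕ → Fin t) (x : Finset ℤ) :
    maxColor n k c x < t := by
  have ht : 0 < t := (Nat.zero_le _).trans_lt (c ∅).2
  rw [maxColor, Finset.sup_lt_iff (by simpa using ht)]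
  exact fun A _ => (c A).2

lemma exists_eq_maxColor {n k t : ℕ} (c : Finset ℕ → Fin t) {x : Finset ℤ}
    (h : ∃ A, SchrijverVertex n k A ∧ ∀ a ∈ A, (a : ℤ) ∈ x) :
    ∃ A, SchrijverVertex n k A ∧ (∀ a ∈ A, (a : ℤ) ∈ x) ∧ (c A : ℕ) = maxColor n k c x := by
  classical
  obtain ⟨A, hA, hAx⟩ := h
  obtain ⟨B, hB, hBe⟩ := exists_mem_eq_sup
    ((Icc 1 n).powerset.filter fun A => SchrijverVertex n k A ∧ ∀ a ∈ A, (a : ℤ) ∈ x)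
    ⟨A, mem_filter.2 ⟨mem_powerset.2 hA.1, hA, hAx⟩⟩ fun A => (c A : ℕ)
  rw [mem_filter] at hB
  refine ⟨B, hB.2.1, hB.2.2, ?_⟩
  rw [maxColor, ← hBe]

lemma colors_lower_bound {n k t : ℕ} (hk : 1 ≤ k) (hn : 2 * k ≤ n) (c : Finset ℕ → Fin t)
    (hc : ∀ A B : Finset ℕ, SchrijverVertex n k A → SchrijverVertex n k B →
      Disjoint A B → c A ≠ c B) : n - 2 * k + 2 ≤ t := by
  by_contra! ht
  let a : Finset ℤ → ℕ := fun x =>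
    if altLength n x < 2 * k ∧ altLength n (-x) < 2 * k then altLength n x
    else 2 * k - 1 + maxColor n k c x
  obtain ⟨x, hx, hne, he⟩ := exists_eq_neg_of_monotone a (n - 1) n (by omega)
    (fun y z hyz _ _ => by
      have h1 := altLength_mono n y z hyz
      have h2 := altLength_mono n (-y) (-z) (neg_subset_neg hyz)
      have h3 := maxColor_mono n k c hyz
      simp only [a]
      split_ifs <;> omega)
    (fun y _ _ => by
      have := maxColor_lt n k c y
      simp only [a]
      split_ifs <;> omega)
  have h1 := altLength_ne_neg n x hx hne
  simp only [a, neg_neg] at he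
  by_cases hlt : altLength n x < 2 * k ∧ altLength n (-x) < 2 * k
  · rw [if_pos hlt, if_pos hlt.symm] at he
    exact h1 he
  · rw [if_neg hlt, if_neg fun h => hlt h.symm] at he
    have hex : (∃ A, SchrijverVertex n k A ∧ ∀ a ∈ A, (a : ℤ) ∈ x) ∧
        ∃ B, SchrijverVertex n k B ∧ ∀ b ∈ B, (b : ℤ) ∈ -x := by
      simp only [mem_neg']
      by_cases h : 2 * k ≤ altLength n x
      · exact exists_schrijverVertex h
      · have h' : 2 * k ≤ altLength n (-x) := by omega
        have := exists_schrijverVertex h'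
        simp only [mem_neg', neg_neg] at this
        exact this.symm
    obtain ⟨A, hA, hAx, hAc⟩ := exists_eq_maxColor c hex.1
    obtain ⟨B, hB, hBx, hBc⟩ := exists_eq_maxColor c hex.2
    refine hc A B hA hB ?_ (Fin.ext (by omega))
    rw [Finset.disjoint_left]
    intro v hv hv'
    exact (hx _ (hAx v hv)).1 (mem_neg'.1 (hBx v hv'))

lemma exists_coloring {n k : ℕ} (hk : 1 ≤ k) (hn : 2 * k ≤ n) :
    ∃ c : Finset ℕ → Fin (n - 2 * k + 2), ∀ A B : Finset ℕ,
      SchrijverVertex n k A → SchrijverVertex n k B → Disjoint A B → c A ≠ c B := by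
  refine ⟨fun A => ⟨min (sInf (A : Set ℕ)) (n - 2 * k + 2) - 1, by omega⟩,
    fun A B hA hB hAB h => ?_⟩
  have hmin : ∀ C, SchrijverVertex n k C → sInf (C : Set ℕ) ∈ C := fun C hC =>
    mem_coe.1 (Nat.sInf_mem (coe_nonempty.2 (card_pos.1 (by have := hC.2.1; omega))))
  have h1 := hmin A hA
  have h2 := hmin B hB
  have h3 := mem_Icc.1 (hA.1 h1)
  have h4 := mem_Icc.1 (hB.1 h2)
  simp only [Fin.mk.injEq] at h
  by_cases heq : sInf (A : Set ℕ) = sInf (B : Set ℕ)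
  · exact Finset.disjoint_left.1 hAB h1 (heq ▸ h2)
  · have hsub : A ∪ B ⊆ Icc (n - 2 * k + 2) n := by
      intro v hv
      rw [mem_Icc]
      rcases mem_union.1 hv with hv | hv
      · have := Nat.sInf_le (mem_coe.2 hv)
        have := mem_Icc.1 (hA.1 hv)
        omega
      · have := Nat.sInf_le (mem_coe.2 hv)
        have := mem_Icc.1 (hB.1 hv)
        omega
    have hcard := card_le_card hsub
    rw [card_union_of_disjoint hAB, hA.2.1, hB.2.1, Nat.card_Icc] at hcard
    omega

end Coloring

end Schrijver

/-- (Schrijver, upper bound and equality) For `n ≥ 2k ≥ 2`, the Schrijver graph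
`KG^2([n] choose k)_{2-stab}` admits a proper coloring with `n - 2k + 2` colors, and
`n - 2k + 2` is the least number of colors of a proper coloring, i.e. the chromatic
number equals `n - 2k + 2`. -/
theorem stmt_15 (n k : ℕ) (hk : 1 ≤ k) (hn : 2 * k ≤ n) :
    IsLeast {t : ℕ | ∃ c : Finset ℕ → Fin t,
        ∀ A B : Finset ℕ, SchrijverVertex n k A → SchrijverVertex n k B →
          Disjoint A B → c A ≠ c B}
      (n - 2 * k + 2) := by
  exact ⟨Schrijver.exists_coloring hk hn,
    fun _ ⟨c, hc⟩ => Schrijver.colors_lower_bound hk hn c hc⟩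
end
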